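/- arXiv:2505.03506 — 12 statements merged into one kernel-verified Lean document; each statement's English description precedes it below -/
import Mathlib

section
/- Let u, v : ℝ → ℝⁿ be two solutions of the gradient flow equation, i.e., u and v are differentiable on [0,∞) with u'(t) = -∇f(u(t)) and v'(t) = -∇f(v(t)) for all t ≥ 0, and suppose u(0) = v(0). Then u(t) = v(t) for all t ≥ 0. -/
open Real Set RealInnerProductSpace

/-- Two forward solutions of `x' = -F x` with `F` a monotone operator that agree at time `0`
agree for all `t ≥ 0`. -/
theorem eq_of_hasDerivAt_neg_monotone {E : Type*} [NormedAddCommGroup E] [InnerProductSpace ℝ E]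
    {F : E → E} (hF : ∀ x y, 0 ≤ ⟪F x - F y, x - y⟫) {u v : ℝ → E}
    (hu : ∀ t : ℝ, 0 ≤ t → HasDerivAt u (-(F (u t))) t)
    (hv : ∀ t : ℝ, 0 ≤ t → HasDerivAt v (-(F (v t))) t)
    (h0 : u 0 = v 0) {t : ℝ} (ht : 0 ≤ t) : u t = v t := by
  have hd (s : ℝ) (hs : 0 ≤ s) := ((hu s hs).sub (hv s hs)).norm_sq
  have hanti : AntitoneOn (fun s => ‖(u - v) s‖ ^ 2) (Ici 0) := by
    refine antitoneOn_of_hasDerivWithinAt_nonpos (convex_Ici 0)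
      (fun s hs => (hd s hs).continuousAt.continuousWithinAt)
      (fun s hs => (hd s (interior_subset hs)).hasDerivWithinAt) fun s _ => ?_
    have h := hF (u s) (v s)
    rw [real_inner_comm] at h
    rw [Pi.sub_apply, neg_sub_neg, ← neg_sub (F (u s)), inner_neg_right]
    linarith
  have h : ‖u t - v t‖ ^ 2 ≤ 0 := by
    simpa [h0] using hanti self_mem_Ici (mem_Ici.2 ht) ht
  exact sub_eq_zero.1 (norm_eq_zero.1 (pow_eq_zero_iff two_ne_zero |>.1 (h.antisymm (sq_nonneg _))))

/-- Two solutions of the gradient flow equation for a `μ`-strongly convex `C¹` function `f`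
that agree at time `0` agree for all `t ≥ 0`. -/
theorem gradient_flow_unique
    {n : ℕ} (f : EuclideanSpace ℝ (Fin n) → ℝ) (μ : ℝ) (hμ : 0 < μ)
    (hf : ContDiff ℝ 1 f)
    (hsc : ∀ x y : EuclideanSpace ℝ (Fin n),
      f x - f y ≥ ⟪gradient f y, x - y⟫ + μ / 2 * ‖x - y‖ ^ 2)
    (u v : ℝ → EuclideanSpace ℝ (Fin n))
    (hu : ∀ t : ℝ, 0 ≤ t → HasDerivAt u (-(gradient f (u t))) t)
    (hv : ∀ t : ℝ, 0 ≤ t → HasDerivAt v (-(gradient f (v t))) t)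
    (h0 : u 0 = v 0) :
    ∀ t : ℝ, 0 ≤ t → u t = v t := by
  refine fun t ht => eq_of_hasDerivAt_neg_monotone (F := gradient f) (fun x y => ?_) hu hv h0 ht
  have hxy := hsc x y
  have hyx := hsc y x
  rw [← neg_sub x y, inner_neg_right, norm_neg] at hyx
  rw [inner_sub_left]
  have : 0 ≤ μ / 2 * ‖x - y‖ ^ 2 := by positivity
  linarith
end

section
/- Let u : ℝ → ℝⁿ be differentiable on [0,∞) with u'(t) = -∇f(u(t)) for all t ≥ 0, and let u* be the unique minimizer of f. Then for all t ≥ 0, ‖u(t) - u*‖ ≤ e^{-μt} ‖u(0) - u*‖. -/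
open Real Set RealInnerProductSpace

/-- The gradient vanishes at a local minimum. -/
theorem IsLocalMin.gradient_eq_zero {F : Type*} [NormedAddCommGroup F] [InnerProductSpace ℝ F]
    [CompleteSpace F] {f : F → ℝ} {a : F} (h : IsLocalMin f a) : gradient f a = 0 := by
  simp [gradient, h.fderiv_eq_zero]

/-- The gradient of a `μ`-strongly convex function is `μ`-strongly monotone. -/
theorem strongly_monotone_gradient_of_strongly_convex {F : Type*} [NormedAddCommGroup F]
    [InnerProductSpace ℝ F] [CompleteSpace F] {f : F → ℝ} {μ : ℝ}
    (hsc : ∀ x y : F, f x - f y ≥ ⟪gradient f y, x - y⟫ + μ / 2 * ‖x - y‖ ^ 2) (x y : F) :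
    μ * ‖x - y‖ ^ 2 ≤ ⟪gradient f x - gradient f y, x - y⟫ := by
  have hxy := hsc x y
  have hyx := hsc y x
  rw [← neg_sub x y, inner_neg_right, norm_neg] at hyx
  rw [inner_sub_left]
  linarith

/-- If `w` satisfies `⟪w, w'⟫ ≤ -μ ‖w‖²` on `[0, ∞)`, then `‖w‖` decays at the rate `e^{-μ t}`. -/
theorem norm_le_exp_mul_of_inner_deriv_le {F : Type*} [NormedAddCommGroup F]
    [InnerProductSpace ℝ F] {w w' : ℝ → F} {μ : ℝ}
    (hw : ∀ t, 0 ≤ t → HasDerivAt w (w' t) t)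
    (hle : ∀ t, 0 ≤ t → ⟪w t, w' t⟫ ≤ -μ * ‖w t‖ ^ 2) {t : ℝ} (ht : 0 ≤ t) :
    ‖w t‖ ≤ Real.exp (-μ * t) * ‖w 0‖ := by
  have hderiv : ∀ s, 0 ≤ s → HasDerivAt (fun s => Real.exp (2 * μ * s) * ‖w s‖ ^ 2)
      (Real.exp (2 * μ * s) * (2 * μ) * ‖w s‖ ^ 2
        + Real.exp (2 * μ * s) * (2 * ⟪w s, w' s⟫)) s := fun s hs =>
    (((hasDerivAt_id s).const_mul (2 * μ)).exp.mul (hw s hs).norm_sq).congr_deriv (by simp)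
  have hanti : AntitoneOn (fun s => Real.exp (2 * μ * s) * ‖w s‖ ^ 2) (Ici 0) := by
    refine antitoneOn_of_hasDerivWithinAt_nonpos (convex_Ici 0)
      (fun s hs => (hderiv s hs).continuousAt.continuousWithinAt)
      (fun s hs => (hderiv s (interior_subset hs)).hasDerivWithinAt) fun s hs => ?_
    have h := mul_le_mul_of_nonneg_left (hle s (interior_subset hs))
      (Real.exp_pos (2 * μ * s)).le
    linarith
  have hsq : Real.exp (2 * μ * t) * ‖w t‖ ^ 2 ≤ ‖w 0‖ ^ 2 := by
    simpa using hanti self_mem_Ici ht ht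
  have hexp : Real.exp (2 * μ * t) = Real.exp (μ * t) ^ 2 := by
    rw [← Real.exp_nat_mul]
    push_cast
    ring_nf
  rw [hexp, ← mul_pow] at hsq
  rw [neg_mul, Real.exp_neg, ← div_eq_inv_mul, le_div_iff₀' (Real.exp_pos _)]
  exact (sq_le_sq₀ (by positivity) (norm_nonneg _)).mp hsq

/-- Along the gradient flow of a `μ`-strongly convex `C¹` function `f`, the distance to the
unique minimizer `u*` decays at the rate `e^{-μ t}`. -/
theorem gradient_flow_exponential_decay
    {n : ℕ} (f : EuclideanSpace ℝ (Fin n) → ℝ) (μ : ℝ) (hμ : 0 < μ)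
    (hf : ContDiff ℝ 1 f)
    (hsc : ∀ x y : EuclideanSpace ℝ (Fin n),
      f x - f y ≥ ⟪gradient f y, x - y⟫ + μ / 2 * ‖x - y‖ ^ 2)
    (u : ℝ → EuclideanSpace ℝ (Fin n))
    (hu : ∀ t : ℝ, 0 ≤ t → HasDerivAt u (-(gradient f (u t))) t)
    (ustar : EuclideanSpace ℝ (Fin n))
    (hmin : ∀ y, f ustar ≤ f y)
    (huniq : ∀ y, (∀ z, f y ≤ f z) → y = ustar) :
    ∀ t : ℝ, 0 ≤ t → ‖u t - ustar‖ ≤ Real.exp (-μ * t) * ‖u 0 - ustar‖ := by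
  intro t ht
  refine norm_le_exp_mul_of_inner_deriv_le (w := fun s => u s - ustar)
    (fun s hs => (hu s hs).sub_const ustar) (fun s _ => ?_) ht
  have hgrad : gradient f ustar = 0 :=
    IsLocalMin.gradient_eq_zero (Filter.Eventually.of_forall hmin)
  have hmono := strongly_monotone_gradient_of_strongly_convex hsc (u s) ustar
  rw [hgrad, sub_zero, real_inner_comm] at hmono
  rw [inner_neg_right]
  linarith
end

section
/- Let u : ℝ → ℝⁿ be differentiable on [0,∞) with u'(t) = -∇f(u(t)) for all t ≥ 0. Then there exists a constant M > 0 such that ‖∇f(u(t))‖ ≤ M for all t ≥ 0 (in particular the trajectory {u(t) : t ≥ 0} is bounded). -/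
open Real Set RealInnerProductSpace

/-- The gradient of a `C¹` function is continuous. -/
theorem continuous_gradient_of_contDiff {E : Type*} [NormedAddCommGroup E]
    [InnerProductSpace ℝ E] [CompleteSpace E] {f : E → ℝ} (hf : ContDiff ℝ 1 f) :
    Continuous (gradient f) :=
  (InnerProductSpace.toDual ℝ E).symm.continuous.comp (hf.continuous_fderiv one_ne_zero)

/-- A differentiable function is nonincreasing along its gradient flow. -/
theorem antitoneOn_comp_gradient_flow {E : Type*} [NormedAddCommGroup E]
    [InnerProductSpace ℝ E] [CompleteSpace E] {f : E → ℝ} (hf : Differentiable ℝ f) {u : ℝ → E}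
    (hu : ∀ t : ℝ, 0 ≤ t → HasDerivAt u (-(gradient f (u t))) t) :
    AntitoneOn (f ∘ u) (Ici 0) := by
  have hderiv : ∀ t : ℝ, 0 ≤ t → HasDerivAt (f ∘ u) (-‖gradient f (u t)‖ ^ 2) t := by
    intro t ht
    have h := (hf (u t)).hasGradientAt.hasFDerivAt.comp_hasDerivAt t (hu t ht)
    rwa [InnerProductSpace.toDual_apply_apply, inner_neg_right, real_inner_self_eq_norm_sq] at h
  refine antitoneOn_of_deriv_nonpos (convex_Ici 0)
    (fun t ht => (hderiv t ht).continuousAt.continuousWithinAt)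
    (fun t ht => (hderiv t (interior_subset ht)).differentiableAt.differentiableWithinAt)
    fun t ht => ?_
  rw [(hderiv t (interior_subset ht)).deriv]
  exact neg_nonpos.2 (sq_nonneg _)

/-- The sublevel set of a strongly convex function through `y` lies in an explicit ball
around `y`. -/
theorem norm_sub_le_of_strongly_convex_of_le {E : Type*} [NormedAddCommGroup E]
    [InnerProductSpace ℝ E] [CompleteSpace E] {f : E → ℝ} {μ : ℝ} (hμ : 0 < μ) {x y : E}
    (hsc : f x - f y ≥ ⟪gradient f y, x - y⟫ + μ / 2 * ‖x - y‖ ^ 2) (hxy : f x ≤ f y) :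
    ‖x - y‖ ≤ 2 * ‖gradient f y‖ / μ := by
  have hcs := neg_le_of_abs_le (abs_real_inner_le_norm (gradient f y) (x - y))
  rw [le_div_iff₀ hμ]
  rcases (norm_nonneg (x - y)).eq_or_lt with h | h
  · simp [← h]
  · refine le_of_mul_le_mul_right ?_ h
    linarith

/-- Along the gradient flow of a `μ`-strongly convex `C¹` function `f`, the gradient along the
trajectory is bounded: there is `M > 0` with `‖∇f(u(t))‖ ≤ M` for all `t ≥ 0` (in particular
the trajectory `{u t : t ≥ 0}` is bounded). -/
theorem gradient_flow_gradient_bounded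
    {n : ℕ} (f : EuclideanSpace ℝ (Fin n) → ℝ) (μ : ℝ) (hμ : 0 < μ)
    (hf : ContDiff ℝ 1 f)
    (hsc : ∀ x y : EuclideanSpace ℝ (Fin n),
      f x - f y ≥ ⟪gradient f y, x - y⟫ + μ / 2 * ‖x - y‖ ^ 2)
    (u : ℝ → EuclideanSpace ℝ (Fin n))
    (hu : ∀ t : ℝ, 0 ≤ t → HasDerivAt u (-(gradient f (u t))) t) :
    (∃ M : ℝ, 0 < M ∧ ∀ t : ℝ, 0 ≤ t → ‖gradient f (u t)‖ ≤ M) ∧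
      Bornology.IsBounded (u '' Ici (0 : ℝ)) := by
  have hball : u '' Ici (0 : ℝ) ⊆ Metric.closedBall (u 0) (2 * ‖gradient f (u 0)‖ / μ) := by
    rintro _ ⟨t, ht, rfl⟩
    rw [mem_closedBall_iff_norm]
    exact norm_sub_le_of_strongly_convex_of_le hμ (hsc _ _)
      (antitoneOn_comp_gradient_flow (hf.differentiable one_ne_zero) hu self_mem_Ici ht ht)
  refine ⟨?_, Metric.isBounded_closedBall.subset hball⟩
  obtain ⟨C, hC⟩ := (isCompact_closedBall (u 0) _).exists_bound_of_continuousOn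
    (continuous_gradient_of_contDiff hf).continuousOn
  exact ⟨max C 1, by positivity, fun t ht =>
    (hC _ (hball (mem_image_of_mem u ht))).trans (le_max_left _ _)⟩
end

section
/- Let u : ℝ → ℝⁿ be differentiable on [0,∞) with u'(t) = -∇f(u(t)) for all t ≥ 0, and suppose M > 0 satisfies ‖∇f(u(t))‖ ≤ M for all t ≥ 0. Then for every stepsize τ with 0 < τ < δ/M and every t ≥ 0, the forward Euler local truncation error satisfies ‖u(t) - τ ∇f(u(t)) - u(t + τ)‖ ≤ β M^α τ^{1+α}. -/
open Real Set RealInnerProductSpace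

/-- Local truncation error of the forward Euler step along the gradient flow of a `μ`-strongly
convex `C¹` function whose gradient is locally `α`-Hölder continuous: for `0 < τ < δ / M`,
`‖u(t) - τ ∇f(u(t)) - u(t+τ)‖ ≤ β M^α τ^{1+α}`. -/
theorem gradient_flow_euler_truncation_error
    {n : ℕ} (f : EuclideanSpace ℝ (Fin n) → ℝ) (μ : ℝ) (hμ : 0 < μ)
    (hf : ContDiff ℝ 1 f)
    (hsc : ∀ x y : EuclideanSpace ℝ (Fin n),
      f x - f y ≥ ⟪gradient f y, x - y⟫ + μ / 2 * ‖x - y‖ ^ 2)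
    (α β δ : ℝ) (hα : 0 < α) (hα1 : α ≤ 1) (hβ : 0 < β) (hδ : 0 < δ)
    (hH : ∀ x y : EuclideanSpace ℝ (Fin n),
      ‖x - y‖ ≤ δ → ‖gradient f x - gradient f y‖ ≤ β * ‖x - y‖ ^ α)
    (u : ℝ → EuclideanSpace ℝ (Fin n))
    (hu : ∀ t : ℝ, 0 ≤ t → HasDerivAt u (-(gradient f (u t))) t)
    (M : ℝ) (hM : 0 < M)
    (hMb : ∀ t : ℝ, 0 ≤ t → ‖gradient f (u t)‖ ≤ M) :
    ∀ τ : ℝ, 0 < τ → τ < δ / M → ∀ t : ℝ, 0 ≤ t →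
      ‖u t - τ • gradient f (u t) - u (t + τ)‖ ≤ β * M ^ α * τ ^ (1 + α) := by
  intro τ hτ hτδ t ht
  have hMτ : M * τ < δ := by rwa [lt_div_iff₀ hM, mul_comm] at hτδ
  have hdist : ∀ s ∈ Icc t (t + τ), ‖u s - u t‖ ≤ M * τ := fun s hs => by
    have hLip := norm_image_sub_le_of_norm_deriv_le_segment' (C := M)
      (fun x hx => (hu x (ht.trans hx.1)).hasDerivWithinAt)
      (fun x hx => by simpa using hMb x (ht.trans hx.1)) s hs
    refine hLip.trans (mul_le_mul_of_nonneg_left ?_ hM.le)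
    linarith [hs.2]
  have hderiv : ∀ s ∈ Icc t (t + τ), HasDerivWithinAt
      (fun r => u r + (r - t) • gradient f (u t))
      (-(gradient f (u s)) + (1 : ℝ) • gradient f (u t)) (Icc t (t + τ)) s := fun s hs =>
    ((hu s (ht.trans hs.1)).add
      (((hasDerivAt_id s).sub_const t).smul_const (gradient f (u t)))).hasDerivWithinAt
  have hbound : ∀ s ∈ Ico t (t + τ),
      ‖-(gradient f (u s)) + (1 : ℝ) • gradient f (u t)‖ ≤ β * (M * τ) ^ α := fun s hs => by
    have hs' := hdist s (Ico_subset_Icc_self hs)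
    rw [one_smul, neg_add_eq_sub, norm_sub_rev]
    refine (hH _ _ (hs'.trans hMτ.le)).trans ?_
    gcongr
  have hend := norm_image_sub_le_of_norm_deriv_le_segment' hderiv hbound (t + τ)
    (right_mem_Icc.2 (by linarith))
  calc ‖u t - τ • gradient f (u t) - u (t + τ)‖
      = ‖u (t + τ) + (t + τ - t) • gradient f (u t) -
          (u t + (t - t) • gradient f (u t))‖ := by
        rw [← norm_neg, add_sub_cancel_left, sub_self, zero_smul]
        congr 1
        abel
    _ ≤ β * (M * τ) ^ α * (t + τ - t) := hend
    _ = β * M ^ α * τ ^ (1 + α) := by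
        rw [add_sub_cancel_left, mul_rpow hM.le hτ.le, rpow_add hτ, rpow_one]
        ring
end

section
/- For every τ > 0 and every pair of points u, v ∈ ℝⁿ with ‖u - v‖ ≤ δ, one has ‖(u - τ ∇f(u)) - (v - τ ∇f(v))‖² ≤ (1 - 2μτ) ‖u - v‖² + β² τ² ‖u - v‖^{2α}. -/
open Real Set RealInnerProductSpace

/-- One-step contraction estimate for the gradient descent map of a `μ`-strongly convex `C¹`
function whose gradient is locally `α`-Hölder continuous: for any `τ > 0` and any `x, y` with
`‖x - y‖ ≤ δ`, `‖(x - τ∇f(x)) - (y - τ∇f(y))‖² ≤ (1 - 2μτ)‖x - y‖² + β²τ²‖x - y‖^{2α}`. -/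
theorem gradient_descent_one_step_estimate
    {n : ℕ} (f : EuclideanSpace ℝ (Fin n) → ℝ) (μ : ℝ) (hμ : 0 < μ)
    (hf : ContDiff ℝ 1 f)
    (hsc : ∀ x y : EuclideanSpace ℝ (Fin n),
      f x - f y ≥ ⟪gradient f y, x - y⟫ + μ / 2 * ‖x - y‖ ^ 2)
    (α β δ : ℝ) (hα : 0 < α) (hα1 : α ≤ 1) (hβ : 0 < β) (hδ : 0 < δ)
    (hH : ∀ x y : EuclideanSpace ℝ (Fin n),
      ‖x - y‖ ≤ δ → ‖gradient f x - gradient f y‖ ≤ β * ‖x - y‖ ^ α) :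
    ∀ τ : ℝ, 0 < τ → ∀ x y : EuclideanSpace ℝ (Fin n), ‖x - y‖ ≤ δ →
      ‖(x - τ • gradient f x) - (y - τ • gradient f y)‖ ^ 2 ≤
        (1 - 2 * μ * τ) * ‖x - y‖ ^ 2 + β ^ 2 * τ ^ 2 * ‖x - y‖ ^ (2 * α) := by
  intro τ hτ x y hxy
  have hmono : μ * ‖x - y‖ ^ 2 ≤ ⟪x - y, gradient f x - gradient f y⟫ := by
    have h₁ := hsc x y
    have h₂ := hsc y x
    rw [← neg_sub x y, inner_neg_right, norm_neg] at h₂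
    rw [real_inner_comm, inner_sub_left]
    linarith
  have hsq : ‖gradient f x - gradient f y‖ ^ 2 ≤ β ^ 2 * ‖x - y‖ ^ (2 * α) := by
    calc ‖gradient f x - gradient f y‖ ^ 2 ≤ (β * ‖x - y‖ ^ α) ^ 2 := by
          gcongr
          exact hH x y hxy
      _ = β ^ 2 * ‖x - y‖ ^ (2 * α) := by
          rw [mul_pow, mul_comm 2 α, rpow_mul (norm_nonneg _), rpow_two]
  have hsplit : (x - τ • gradient f x) - (y - τ • gradient f y) =
      (x - y) - τ • (gradient f x - gradient f y) := by
    rw [smul_sub]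
    abel
  rw [hsplit, norm_sub_sq_real, real_inner_smul_right, norm_smul, mul_pow, norm_eq_abs, sq_abs]
  linarith [mul_le_mul_of_nonneg_left hmono hτ.le, mul_le_mul_of_nonneg_left hsq (sq_nonneg τ)]
end

section
/- Let u : ℝ → ℝⁿ be differentiable on [0,∞) with u'(t) = -∇f(u(t)) for all t ≥ 0, let M > 0 satisfy ‖∇f(u(t))‖ ≤ M for all t ≥ 0, and set C_E = β M^α / μ. Fix T > 0 and a positive integer K with K ≥ max{ T, 4μT, MT/δ, C_E^{1/α} T / δ^{1/α}, (2β²)^{1/((1-α)²+α²)} T^{1 + 1/((1-α)²+α²)} / C_E^{2(1-α)/((1-α)²+α²)} }, and set τ = T/K. Define the forward Euler iterates by u_0 = u(0) and u_{k+1} = u_k - τ ∇f(u_k). Then for every 0 ≤ l ≤ K, the discretization error satisfies ‖u_l - u(τ l)‖ ≤ C_E τ^α. -/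
open Real Set RealInnerProductSpace

/-- A normalized error satisfying the one-step error recursion of the explicit Euler method stays
below `1` during the first `K` steps. -/
theorem le_one_of_euler_recursion {K : ℕ} {m : ℝ} (hm : 0 < m) (hm4 : m ≤ 1 / 4)
    {x : ℕ → ℝ} (hx : ∀ k, 0 ≤ x k) (hx0 : x 0 = 0)
    (hrec : ∀ k, x k ≤ 1 → x (k + 1) ≤ √((1 - 2 * m) * x k ^ 2 + 1 / (2 * K)) + 4 / 5 * m) :
    ∀ l ≤ K, x l ≤ 1 := by
  rcases Nat.eq_zero_or_pos K with rfl | hK0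
  · intro l hl
    simp [Nat.le_zero.mp hl, hx0]
  have hK : (1 : ℝ) ≤ K := by exact_mod_cast hK0
  set w : ℝ := 1 / (2 * K) with hw
  have hwK : w * K = 1 / 2 := by rw [hw]; field_simp
  have hw0 : 0 < w := by positivity
  clear_value w
  rcases le_or_gt (5 / 4) (m * K) with ha | ha
  · have hw2 : w ≤ 2 / 5 * m := by
      have : w * K ≤ 2 / 5 * m * K := by linarith
      exact le_of_mul_le_mul_right this (by linarith)
    intro l _
    induction l with
    | zero => simp [hx0]
    | succ k ih =>
      have h1 := ih (by omega)
      have h2 : √((1 - 2 * m) * x k ^ 2 + w) ≤ 1 - 4 / 5 * m := by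
        apply Real.sqrt_le_iff.mpr
        refine ⟨by linarith, ?_⟩
        have : x k ^ 2 ≤ 1 := pow_le_one₀ (hx k) h1
        nlinarith
      linarith [hrec k h1]
  · set q : ℝ := 6 / 5 * m + 8 / 5 * m ^ 2 with hq
    set r : ℝ := w * (1 + 4 / 5 * m) + 4 / 5 * m + 16 / 25 * m ^ 2 with hr
    have hq0 : 0 < q := by positivity
    have hr0 : 0 < r := by positivity
    have hq1 : q ≤ 1 := by rw [hq]; nlinarith
    have ha0 : 0 < m * K := by positivity
    have hsum : r * (1 - (1 - q) ^ K) ≤ q := by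
      rcases Nat.lt_or_ge K 2 with h | h
      · obtain rfl : K = 1 := by omega
        have hw1 : w = 1 / 2 := by simpa using hwK
        have : r ≤ 1 := by rw [hr, hw1]; nlinarith
        simp only [pow_one]
        nlinarith
      · have hK2 : (2 : ℝ) ≤ K := by exact_mod_cast h
        have h1 := one_add_mul_self_le_rpow_one_add (s := -q) (by linarith) (p := (K : ℝ) / 2)
          (by linarith)
        have h2 : ((1 + -q) ^ ((K : ℝ) / 2)) ^ 2 = (1 - q) ^ K := by
          rw [← Real.rpow_natCast, ← Real.rpow_mul (by linarith), ← Real.rpow_natCast]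
          congr 1
          push_cast; ring
        have hc : K * q = 6 / 5 * (m * K) + 8 / 5 * (m * K) * m := by rw [hq]; ring
        have hc2 : K * q ≤ 2 := by rw [hc]; nlinarith
        have h3 : (1 - K * q / 2) ^ 2 ≤ (1 - q) ^ K := by
          rw [← h2]
          apply pow_le_pow_left₀ <;> linarith
        have hd : K * r = (1 / 2 + 4 / 5 * (m * K)) * (1 + 4 / 5 * m) := by
          rw [hr]; linear_combination (1 + 4 / 5 * m) * hwK
        have h4 : K * r * (1 - K * q / 4) ≤ 1 := by
          rw [hd, hc]
          generalize m * K = a at *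
          nlinarith [mul_nonneg hm.le (sub_nonneg.2 hm4), mul_nonneg ha0.le (sub_nonneg.2 ha.le),
            mul_pos hm ha0, mul_nonneg hm.le (sub_nonneg.2 ha.le),
            mul_nonneg ha0.le (sub_nonneg.2 hm4),
            mul_nonneg (mul_nonneg hm.le ha0.le) (sub_nonneg.2 ha.le),
            mul_nonneg (mul_nonneg hm.le ha0.le) (sub_nonneg.2 hm4), sq_nonneg (a - 1),
            mul_nonneg (sub_nonneg.2 hm4) (sub_nonneg.2 ha.le)]
        calc r * (1 - (1 - q) ^ K) ≤ r * (1 - (1 - K * q / 2) ^ 2) := by gcongr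
          _ = q * (K * r * (1 - K * q / 4)) := by ring
          _ ≤ q * 1 := by gcongr
          _ = q := mul_one q
    have hle : ∀ l ≤ K, q * x l ^ 2 ≤ r * (1 - (1 - q) ^ l) → x l ≤ 1 := by
      intro l hl h
      have : (1 - q) ^ K ≤ (1 - q) ^ l :=
        pow_le_pow_of_le_one (by linarith) (by linarith) hl
      have h2 : q * x l ^ 2 ≤ q * 1 := by nlinarith
      exact (sq_le_one_iff₀ (hx l)).mp (le_of_mul_le_mul_left h2 hq0)
    have key : ∀ l ≤ K, q * x l ^ 2 ≤ r * (1 - (1 - q) ^ l) := by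
      intro l hl
      induction l with
      | zero => simp [hx0]
      | succ k ih =>
        have ih := ih (by omega)
        have hxk : x k ≤ 1 := hle k (by omega) ih
        have h1 := hrec k hxk
        have hA : 0 ≤ (1 - 2 * m) * x k ^ 2 + w := by
          have := mul_nonneg (by linarith : 0 ≤ 1 - 2 * m) (sq_nonneg (x k))
          linarith
        have h2 := Real.sq_sqrt hA
        set s := √((1 - 2 * m) * x k ^ 2 + w)
        have h3 : x (k + 1) ^ 2 ≤ (s + 4 / 5 * m) ^ 2 := pow_le_pow_left₀ (hx _) h1 2
        have h4 : x (k + 1) ^ 2 ≤ (1 - q) * x k ^ 2 + r := by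
          have h5 : 0 ≤ m * (s - 1) ^ 2 := by positivity
          rw [hq, hr]
          linear_combination h3 + 4 / 5 * h5 + (1 + 4 / 5 * m) * h2
        have h5 := mul_le_mul_of_nonneg_left h4 hq0.le
        have h6 := mul_le_mul_of_nonneg_left ih (by linarith : 0 ≤ 1 - q)
        rw [pow_succ (1 - q)]
        linarith
    exact fun l hl => hle l hl (key l hl)

/-- For small Hölder exponents `α`, the contraction of an Euler step leaves enough room for the
expansion caused by a merely Hölder continuous gradient. -/
theorem sq_le_rpow_sq_mul {α m : ℝ} (hα : 0 < α) (hα4 : α ≤ 1 / 4)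
    (hm : 0 < m) (hm4 : m ≤ 1 / 4) :
    m ^ 2 ≤ ((4 / 5 * m) ^ α) ^ 2 * (2 * m * α / (1 + α) + m ^ 2 / (1 + α) ^ 2) := by
  set r : ℝ := √((4 / 5 * m)⁻¹) with hr
  have hr2 : r ^ 2 = (4 / 5 * m)⁻¹ := Real.sq_sqrt (by positivity)
  have hr0 : 0 < r := by positivity
  have hmr : m * r ^ 2 = 5 / 4 := by rw [hr2]; field_simp
  have hr5 : 5 ≤ r ^ 2 := by nlinarith [sq_nonneg r]
  have hr22 : 2.236 ≤ r := by nlinarith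
  have hB : r ^ (4 * α) ≤ 1 + 4 * α * (r - 1) := by
    have := rpow_one_add_le_one_add_mul_self (s := r - 1) (by linarith) (p := 4 * α)
      (by linarith) (by linarith)
    simpa using this
  have hinv : ((4 / 5 * m) ^ α) ^ 2 * r ^ (4 * α) = 1 := by
    have : r ^ (4 * α) = (((4 / 5 * m) ^ α)⁻¹) ^ 2 := by
      rw [← Real.inv_rpow (by positivity), ← hr2, ← Real.rpow_natCast r, ← Real.rpow_natCast,
        ← Real.rpow_mul hr0.le, ← Real.rpow_mul hr0.le]
      congr 1
      push_cast; ring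
    rw [this]
    have : 0 < (4 / 5 * m) ^ α := by positivity
    field_simp
  have hmain : m ^ 2 * (1 + 4 * α * (r - 1)) ≤ 2 * m * α / (1 + α) + m ^ 2 / (1 + α) ^ 2 := by
    have hpoly : (2 + α) + 4 * (1 + α) ^ 2 * (r - 1) ≤ 8 / 5 * r ^ 2 * (1 + α) := by
      have h1 : 9 / 4 + 5 * (5 / 4) * (r - 1) ≤ 2 * r ^ 2 := by nlinarith
      have h0 : 2 + 4 * (r - 1) ≤ 8 / 5 * r ^ 2 := by nlinarith
      nlinarith [mul_nonneg (mul_nonneg hα.le (by linarith : 0 ≤ 1 / 4 - α))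
        (by linarith : 0 ≤ r - 1), mul_le_mul_of_nonneg_left h1 hα.le,
        mul_le_mul_of_nonneg_left h0 (by linarith : 0 ≤ 1 / 4 - α)]
    have e : 2 * m * α / (1 + α) + m ^ 2 / (1 + α) ^ 2 - m ^ 2 * (1 + 4 * α * (r - 1)) =
        m ^ 2 * α / (1 + α) ^ 2 *
          (8 / 5 * r ^ 2 * (1 + α) - ((2 + α) + 4 * (1 + α) ^ 2 * (r - 1))) := by
      have : 2 * m * α / (1 + α) = 8 / 5 * m ^ 2 * r ^ 2 * α / (1 + α) := by
        congr 1
        linear_combination -8 / 5 * m * α * hmr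
      rw [this]
      field_simp
      ring
    have : 0 ≤ m ^ 2 * α / (1 + α) ^ 2 *
          (8 / 5 * r ^ 2 * (1 + α) - ((2 + α) + 4 * (1 + α) ^ 2 * (r - 1))) :=
      mul_nonneg (by positivity) (by linarith)
    linarith
  calc m ^ 2 = ((4 / 5 * m) ^ α) ^ 2 * (m ^ 2 * r ^ (4 * α)) := by
        linear_combination -m ^ 2 * hinv
    _ ≤ ((4 / 5 * m) ^ α) ^ 2 * (m ^ 2 * (1 + 4 * α * (r - 1))) := by gcongr
    _ ≤ _ := by gcongr

/-- One explicit Euler step for a strongly monotone field expands distances in a controlled way. -/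
theorem norm_sub_smul_sq_le {E : Type*} [NormedAddCommGroup E]
    [InnerProductSpace ℝ E] {e g : E} {μ τ G : ℝ} (hτ : 0 ≤ τ)
    (hmono : μ * ‖e‖ ^ 2 ≤ ⟪g, e⟫) (hg : ‖g‖ ≤ G) :
    ‖e - τ • g‖ ^ 2 ≤ (1 - 2 * (μ * τ)) * ‖e‖ ^ 2 + (τ * G) ^ 2 := by
  rw [norm_sub_sq_real, real_inner_smul_right, norm_smul, real_inner_comm, Real.norm_of_nonneg hτ]
  have : (τ * ‖g‖) ^ 2 ≤ (τ * G) ^ 2 := by gcongr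
  nlinarith [mul_le_mul_of_nonneg_left hmono hτ]

/-- The gradient of a strongly convex function is strongly monotone. -/
theorem gradient_strongly_monotone {E : Type*} [NormedAddCommGroup E]
    [InnerProductSpace ℝ E] [CompleteSpace E] {f : E → ℝ} {μ : ℝ}
    (hsc : ∀ x y : E, f x - f y ≥ ⟪gradient f y, x - y⟫ + μ / 2 * ‖x - y‖ ^ 2) (x y : E) :
    μ * ‖x - y‖ ^ 2 ≤ ⟪gradient f x - gradient f y, x - y⟫ := by
  have h1 := hsc x y
  have h2 := hsc y x
  rw [← neg_sub x y, inner_neg_right, norm_neg] at h2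
  rw [inner_sub_left]
  linarith

/-- Local truncation error of the explicit Euler method, in terms of the Hölder modulus. -/
theorem norm_truncation_le_holder {E : Type*} [NormedAddCommGroup E]
    [InnerProductSpace ℝ E] {g : E → E} {u : ℝ → E} {α β δ M τ t : ℝ} (hα : 0 < α)
    (hβ : 0 < β) (hM : 0 < M) (hτ : 0 ≤ τ) (ht : 0 ≤ t)
    (hH : ∀ x y : E, ‖x - y‖ ≤ δ → ‖g x - g y‖ ≤ β * ‖x - y‖ ^ α)
    (hu : ∀ t : ℝ, 0 ≤ t → HasDerivAt u (-(g (u t))) t)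
    (hMb : ∀ t : ℝ, 0 ≤ t → ‖g (u t)‖ ≤ M) (hδ : M * τ ≤ δ) :
    ‖u (t + τ) - u t + τ • g (u t)‖ ≤ τ * (β * (M * τ) ^ α) / (1 + α) := by
  have hshift : ∀ s, 0 ≤ s → HasDerivAt (fun s => u (t + s)) (-(g (u (t + s)))) s := fun s hs => by
    simpa using (hu (t + s) (by linarith)).comp_const_add t s
  have hlip : ∀ s ∈ Icc 0 τ, ‖u (t + s) - u t‖ ≤ M * s := by
    have := norm_image_sub_le_of_norm_deriv_le_segment' (f := fun s => u (t + s)) (a := 0) (b := τ)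
      (C := M) (fun s hs => (hshift s hs.1).hasDerivWithinAt)
      (fun s hs => by rw [norm_neg]; exact hMb _ (by linarith [hs.1]))
    simpa using this
  have hψ : ∀ s, 0 ≤ s → HasDerivAt (fun s => u (t + s) - u t + s • g (u t))
      (-(g (u (t + s))) + (1 : ℝ) • g (u t)) s := fun s hs =>
    ((hshift s hs).sub_const _).add ((hasDerivAt_id s).smul_const _)
  have hB : ∀ s, HasDerivAt (fun s : ℝ => β * M ^ α * s ^ (α + 1) / (1 + α))
      (β * M ^ α * s ^ α) s := fun s => by
    have := (((Real.hasDerivAt_rpow_const (x := s) (p := α + 1) (Or.inr (by linarith))).const_mul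
      (β * M ^ α)).div_const (1 + α))
    refine this.congr_deriv ?_
    rw [add_sub_cancel_right]
    field_simp
    ring
  have hfin := image_norm_le_of_norm_deriv_right_le_deriv_boundary (a := 0) (b := τ)
    (f := fun s => u (t + s) - u t + s • g (u t))
    (fun s hs => (hψ s hs.1).continuousAt.continuousWithinAt)
    (fun s hs => (hψ s hs.1).hasDerivWithinAt) (B := fun s : ℝ => β * M ^ α * s ^ (α + 1) / (1 + α))
    (by simp [Real.zero_rpow (by linarith : α + 1 ≠ 0)]) hB
    (fun s hs => by
      have h1 := hlip s ⟨hs.1, hs.2.le⟩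
      have h2 : M * s ≤ M * τ := by gcongr; exact hs.2.le
      rw [one_smul, neg_add_eq_sub, norm_sub_rev, mul_assoc, ← Real.mul_rpow hM.le hs.1]
      refine (hH _ _ (by linarith)).trans ?_
      gcongr) (right_mem_Icc.mpr hτ)
  refine hfin.trans (le_of_eq ?_)
  rcases hτ.eq_or_lt with rfl | hτ'
  · simp [Real.zero_rpow (by linarith : α + 1 ≠ 0)]
  · rw [Real.mul_rpow hM.le hτ, Real.rpow_add_one hτ'.ne']
    ring

/-- For the gradient flow of a convex function, the local truncation error of the explicit Euler
method is at most the length of the Euler step. -/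
theorem norm_truncation_le_step {E : Type*} [NormedAddCommGroup E]
    [InnerProductSpace ℝ E] [CompleteSpace E] {f : E → ℝ} {u : ℝ → E} {τ t : ℝ} (hτ : 0 ≤ τ)
    (ht : 0 ≤ t) (hf : Differentiable ℝ f)
    (hc : ∀ x y : E, ⟪gradient f y, x - y⟫ ≤ f x - f y)
    (hu : ∀ t : ℝ, 0 ≤ t → HasDerivAt u (-(gradient f (u t))) t) :
    ‖u (t + τ) - u t + τ • gradient f (u t)‖ ≤ τ * ‖gradient f (u t)‖ := by
  have hshift : ∀ s, 0 ≤ s → HasDerivAt (fun s => u (t + s)) (-(gradient f (u (t + s)))) s :=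
    fun s hs => by simpa using (hu (t + s) (by linarith)).comp_const_add t s
  have hfu : ∀ s, 0 ≤ s →
      HasDerivAt (fun s => f (u (t + s))) (-‖gradient f (u (t + s))‖ ^ 2) s := fun s hs => by
    have h := (hf (u (t + s))).hasGradientAt.hasFDerivAt.comp_hasDerivAt s (hshift s hs)
    refine h.congr_deriv ?_
    rw [InnerProductSpace.toDual_apply_apply, inner_neg_right, real_inner_self_eq_norm_sq]
  have hh : ∀ s, 0 ≤ s → HasDerivAt
      (fun s => 2 * s * (f (u t) - f (u (t + s))) - ‖u (t + s) - u t‖ ^ 2)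
      (2 * 1 * (f (u t) - f (u (t + s))) + 2 * s * (-(-‖gradient f (u (t + s))‖ ^ 2)) -
        2 * ⟪u (t + s) - u t, -(gradient f (u (t + s)))⟫) s := fun s hs =>
    ((((hasDerivAt_id s).const_mul 2).mul ((hfu s hs).const_sub _))).sub
      ((hshift s hs).sub_const _).norm_sq
  have hmono : MonotoneOn (fun s => 2 * s * (f (u t) - f (u (t + s))) - ‖u (t + s) - u t‖ ^ 2)
      (Ici 0) := by
    refine monotoneOn_of_deriv_nonneg (convex_Ici 0)
      (fun s hs => (hh s hs).continuousAt.continuousWithinAt)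
      (fun s hs => (hh s (interior_subset hs)).differentiableAt.differentiableWithinAt)
      fun s hs => ?_
    have hs0 : 0 ≤ s := interior_subset hs
    rw [(hh s hs0).deriv]
    have h1 := hc (u t) (u (t + s))
    rw [← neg_sub (u (t + s)), inner_neg_right] at h1
    rw [inner_neg_right, real_inner_comm]
    nlinarith [mul_nonneg hs0 (sq_nonneg ‖gradient f (u (t + s))‖)]
  have h0 := hmono (mem_Ici.mpr le_rfl) (mem_Ici.mpr hτ) hτ
  simp only [mul_zero, add_zero, sub_self, norm_zero, ne_eq, OfNat.ofNat_ne_zero,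
    not_false_eq_true, zero_pow] at h0
  have h1 := hc (u (t + τ)) (u t)
  refine le_of_sq_le_sq ?_ (by positivity)
  rw [norm_add_sq_real, real_inner_smul_right, norm_smul, Real.norm_of_nonneg hτ, real_inner_comm]
  nlinarith [mul_le_mul_of_nonneg_left h1 hτ]

/-- The last lower bound on the number of steps controls the expansion of one Euler step. -/
theorem euler_growth_le {α β C T : ℝ} {K : ℕ} (hβ : 0 < β) (hC : 0 < C) (hT : 0 < T)
    (hK0 : 0 < K)
    (hK : (2 * β ^ 2) ^ (1 / ((1 - α) ^ 2 + α ^ 2)) * T ^ (1 + 1 / ((1 - α) ^ 2 + α ^ 2)) /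
          C ^ (2 * (1 - α) / ((1 - α) ^ 2 + α ^ 2)) ≤ K) :
    (T / K * (β * (C * (T / K) ^ α) ^ α)) ^ 2 ≤ (C * (T / K) ^ α) ^ 2 * (1 / (2 * K)) := by
  have hKr : (0 : ℝ) < K := by exact_mod_cast hK0
  set p := (1 - α) ^ 2 + α ^ 2 with hp
  have hp0 : 0 < p := by nlinarith [sq_nonneg (2 * α - 1)]
  set τ := T / K with hτ
  have hτ0 : 0 < τ := by positivity
  have hτK : τ * K = T := by rw [hτ]; field_simp
  have h1 : 2 * β ^ 2 * T ^ (p + 1) / C ^ (2 * (1 - α)) ≤ (K : ℝ) ^ p := by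
    have := Real.rpow_le_rpow (by positivity) hK hp0.le
    rw [Real.div_rpow (by positivity) (by positivity), Real.mul_rpow (by positivity)
      (by positivity), ← Real.rpow_mul (by positivity), ← Real.rpow_mul (by positivity),
      ← Real.rpow_mul (by positivity), one_div_mul_cancel hp0.ne', Real.rpow_one,
      div_mul_cancel₀ _ hp0.ne', add_mul, one_mul, one_div_mul_cancel hp0.ne'] at this
    exact this
  have h2 : 2 * β ^ 2 * T * τ ^ p ≤ C ^ (2 * (1 - α)) := by
    rw [Real.rpow_add_one hT.ne', div_le_iff₀ (by positivity)] at h1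
    rw [hτ, Real.div_rpow hT.le hKr.le]
    rw [mul_div_assoc', div_le_iff₀ (by positivity)]
    linarith
  have h3 : (C * τ ^ α) ^ α = C ^ α * τ ^ (α * α) := by
    rw [Real.mul_rpow hC.le (by positivity), ← Real.rpow_mul hτ0.le]
  have hCC : C ^ 2 = C ^ (2 * (1 - α)) * (C ^ α) ^ 2 := by
    rw [← Real.rpow_natCast, ← Real.rpow_natCast, ← Real.rpow_mul hC.le, ← Real.rpow_add hC]
    congr 1
    push_cast; ring
  have hα2 : 1 + α * α * ((2 : ℕ) : ℝ) ≠ 0 := by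
    have := mul_self_nonneg α
    push_cast
    linarith
  have hττ : τ * (τ ^ (α * α)) ^ 2 = τ ^ p * (τ ^ α) ^ 2 := by
    rw [← Real.rpow_natCast, ← Real.rpow_natCast, ← Real.rpow_mul hτ0.le, ← Real.rpow_mul hτ0.le,
      ← Real.rpow_add hτ0, ← Real.rpow_one_add' hτ0.le hα2]
    congr 1
    rw [hp]
    push_cast; ring
  rw [mul_one_div, le_div_iff₀ (by positivity), h3]
  calc (τ * (β * (C ^ α * τ ^ (α * α)))) ^ 2 * (2 * K)
      = 2 * β ^ 2 * (τ * K) * (C ^ α) ^ 2 * (τ * (τ ^ (α * α)) ^ 2) := by ring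
    _ = (2 * β ^ 2 * T * τ ^ p) * ((C ^ α) ^ 2 * (τ ^ α) ^ 2) := by rw [hτK, hττ]; ring
    _ ≤ C ^ (2 * (1 - α)) * ((C ^ α) ^ 2 * (τ ^ α) ^ 2) := by gcongr
    _ = (C * τ ^ α) ^ 2 := by rw [mul_pow, hCC]; ring

/-- Discretization error of the forward Euler method for the gradient flow of a `μ`-strongly
convex `C¹` function with locally `α`-Hölder continuous gradient: if the number of steps `K`
is large enough, then `‖u_l - u(τ l)‖ ≤ C_E τ^α` for all `0 ≤ l ≤ K`, where
`C_E = β M^α / μ` and `τ = T / K`. -/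
theorem euler_discretization_error
    {n : ℕ} (f : EuclideanSpace ℝ (Fin n) → ℝ) (μ : ℝ) (hμ : 0 < μ)
    (hf : ContDiff ℝ 1 f)
    (hsc : ∀ x y : EuclideanSpace ℝ (Fin n),
      f x - f y ≥ ⟪gradient f y, x - y⟫ + μ / 2 * ‖x - y‖ ^ 2)
    (α β δ : ℝ) (hα : 0 < α) (hα1 : α ≤ 1) (hβ : 0 < β) (hδ : 0 < δ)
    (hH : ∀ x y : EuclideanSpace ℝ (Fin n),
      ‖x - y‖ ≤ δ → ‖gradient f x - gradient f y‖ ≤ β * ‖x - y‖ ^ α)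
    (u : ℝ → EuclideanSpace ℝ (Fin n))
    (hu : ∀ t : ℝ, 0 ≤ t → HasDerivAt u (-(gradient f (u t))) t)
    (M : ℝ) (hM : 0 < M)
    (hMb : ∀ t : ℝ, 0 ≤ t → ‖gradient f (u t)‖ ≤ M)
    (C_E : ℝ) (hCE : C_E = β * M ^ α / μ)
    (T : ℝ) (hT : 0 < T) (K : ℕ) (hK0 : 0 < K)
    (hK : (K : ℝ) ≥ max (max (max (max T (4 * μ * T)) (M * T / δ))
        (C_E ^ (1 / α) * T / δ ^ (1 / α)))
        ((2 * β ^ 2) ^ (1 / ((1 - α) ^ 2 + α ^ 2)) * T ^ (1 + 1 / ((1 - α) ^ 2 + α ^ 2)) /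
          C_E ^ (2 * (1 - α) / ((1 - α) ^ 2 + α ^ 2))))
    (τ : ℝ) (hτ : τ = T / K)
    (uk : ℕ → EuclideanSpace ℝ (Fin n)) (huk0 : uk 0 = u 0)
    (hukrec : ∀ k : ℕ, uk (k + 1) = uk k - τ • gradient f (uk k)) :
    ∀ l : ℕ, l ≤ K → ‖uk l - u (τ * l)‖ ≤ C_E * τ ^ α := by
  have hKr : (0 : ℝ) < K := by exact_mod_cast hK0
  have hτ0 : 0 < τ := by rw [hτ]; positivity
  have hC0 : 0 < C_E := by rw [hCE]; positivity
  have hτK : τ * K = T := by rw [hτ]; field_simp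
  simp only [ge_iff_le, max_le_iff] at hK
  obtain ⟨⟨⟨⟨-, hK2⟩, hK3⟩, hK4⟩, hK5⟩ := hK
  have hgrow := euler_growth_le hβ hC0 hT hK0 hK5
  rw [← hτ] at hgrow
  have hm0 : 0 < μ * τ := by positivity
  have hm4 : μ * τ ≤ 1 / 4 := by
    rw [hτ, mul_div_assoc', div_le_iff₀ hKr]
    linarith
  have hMτ : M * τ ≤ δ := by
    rw [div_le_iff₀ hδ] at hK3
    rw [hτ, mul_div_assoc', div_le_iff₀ hKr]
    linarith
  have hEδ : C_E * τ ^ α ≤ δ := by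
    have h1 : C_E ^ (1 / α) * τ ≤ δ ^ (1 / α) := by
      rw [div_le_iff₀ (by positivity)] at hK4
      rw [hτ, mul_div_assoc', div_le_iff₀ hKr]
      linarith
    have h2 := Real.rpow_le_rpow (by positivity) h1 hα.le
    rwa [Real.mul_rpow (by positivity) hτ0.le, ← Real.rpow_mul hC0.le, ← Real.rpow_mul hδ.le,
      one_div_mul_cancel hα.ne', Real.rpow_one, Real.rpow_one] at h2
  have hE0 : 0 < C_E * τ ^ α := by positivity
  have hEμ : μ * (C_E * τ ^ α) = β * (M * τ) ^ α := by
    rw [hCE, Real.mul_rpow hM.le hτ0.le]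
    field_simp
  set E := C_E * τ ^ α with hE
  set m := μ * τ with hm
  have hstep : ∀ k : ℕ, ‖uk k - u (τ * k)‖ ≤ E → ‖uk (k + 1) - u (τ * (k + 1 : ℕ))‖ ≤
      √((1 - 2 * m) * ‖uk k - u (τ * k)‖ ^ 2 + (τ * (β * E ^ α)) ^ 2) +
        ‖u (τ * k + τ) - u (τ * k) + τ • gradient f (u (τ * k))‖ := by
    intro k hk
    have hg : ‖gradient f (uk k) - gradient f (u (τ * k))‖ ≤ β * E ^ α :=
      (hH _ _ (hk.trans hEδ)).trans (by gcongr)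
    have h1 := Real.le_sqrt_of_sq_le (norm_sub_smul_sq_le hτ0.le
      (gradient_strongly_monotone hsc (uk k) (u (τ * k))) hg)
    have h2 : uk (k + 1) - u (τ * (k + 1 : ℕ)) = ((uk k - u (τ * k)) -
        τ • (gradient f (uk k) - gradient f (u (τ * k)))) -
          (u (τ * k + τ) - u (τ * k) + τ • gradient f (u (τ * k))) := by
      rw [hukrec, smul_sub]
      push_cast
      rw [mul_add, mul_one]
      abel
    rw [h2]
    exact (norm_sub_le _ _).trans (by gcongr)
  have hR1 : ∀ k : ℕ, ‖u (τ * k + τ) - u (τ * k) + τ • gradient f (u (τ * k))‖ ≤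
      m * E / (1 + α) := by
    intro k
    have := norm_truncation_le_holder hα hβ hM hτ0.le (by positivity : 0 ≤ τ * k) hH hu hMb hMτ
    rw [← hEμ] at this
    refine this.trans (le_of_eq ?_)
    rw [hm]; ring
  have hR2 : ∀ k : ℕ, ‖u (τ * k + τ) - u (τ * k) + τ • gradient f (u (τ * k))‖ ≤ M * τ := by
    intro k
    have hk0 : 0 ≤ τ * k := by positivity
    refine (norm_truncation_le_step hτ0.le hk0 (hf.differentiable one_ne_zero)
      (fun x y => ?_) hu).trans ?_
    · have := hsc x y
      have : 0 ≤ μ / 2 * ‖x - y‖ ^ 2 := by positivity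
      linarith
    · rw [mul_comm]
      gcongr
      exact hMb _ hk0
  have h0 : ‖uk 0 - u (τ * (0 : ℕ))‖ = 0 := by simp [huk0]
  by_cases hcase : 1 / 4 ≤ α ∨ M * τ ≤ 4 / 5 * m * E
  · have hR : ∀ k : ℕ, ‖u (τ * k + τ) - u (τ * k) + τ • gradient f (u (τ * k))‖ ≤
        4 / 5 * m * E := by
      intro k
      rcases hcase with h | h
      · refine (hR1 k).trans ?_
        rw [div_le_iff₀ (by linarith)]
        have : 0 < m * E := by positivity
        nlinarith
      · exact (hR2 k).trans h
    have key := le_one_of_euler_recursion (K := K) hm0 hm4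
      (x := fun k => ‖uk k - u (τ * k)‖ / E) (fun k => by positivity) (by simp [huk0]) (by
        intro k hk
        rw [div_le_one hE0] at hk
        rw [div_le_iff₀ hE0]
        refine (hstep k hk).trans ?_
        rw [add_mul]
        refine add_le_add ?_ (hR k)
        refine (Real.sqrt_le_sqrt (add_le_add_right hgrow _)).trans (le_of_eq ?_)
        rw [← Real.sqrt_sq hE0.le, ← Real.sqrt_mul' _ (sq_nonneg _), Real.sqrt_sq hE0.le]
        congr 1
        field_simp)
    intro l hl
    exact (div_le_one hE0).mp (key l hl)
  · push Not at hcase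
    obtain ⟨hα4, hκ⟩ := hcase
    have hgrow' : (τ * (β * E ^ α)) ^ 2 ≤
        E ^ 2 * (2 * m * α / (1 + α) + m ^ 2 / (1 + α) ^ 2) := by
      have h1 : β * ((4 / 5 * m) ^ α * E ^ α) ≤ μ * E := by
        rw [hEμ, ← Real.mul_rpow (by positivity) hE0.le]
        gcongr
      have hc0 : 0 < (4 / 5 * m) ^ α := by positivity
      have h2 : (4 / 5 * m) ^ α * (τ * (β * E ^ α)) ≤ m * E := by
        rw [hm]
        nlinarith [mul_le_mul_of_nonneg_left h1 hτ0.le]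
      have h3 := pow_le_pow_left₀ (by positivity) h2 2
      rw [mul_pow, mul_pow m] at h3
      have h4 := mul_le_mul_of_nonneg_left (sq_le_rpow_sq_mul hα hα4.le hm0 hm4) (sq_nonneg E)
      refine le_of_mul_le_mul_left (a := ((4 / 5 * m) ^ α) ^ 2) ?_ (by positivity)
      linarith
    intro l _
    induction l with
    | zero => rw [h0]; exact hE0.le
    | succ k ih =>
      have hk := ih (by omega)
      have hsqrt : √((1 - 2 * m) * ‖uk k - u (τ * k)‖ ^ 2 + (τ * (β * E ^ α)) ^ 2) ≤
          E - m * E / (1 + α) := by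
        have hmα : m / (1 + α) ≤ 1 := by
          rw [div_le_one (by linarith)]; linarith
        have e : E - m * E / (1 + α) = E * (1 - m / (1 + α)) := by ring
        rw [Real.sqrt_le_iff, e]
        refine ⟨mul_nonneg hE0.le (by linarith), ?_⟩
        have h1 : (1 - 2 * m) * ‖uk k - u (τ * k)‖ ^ 2 ≤ (1 - 2 * m) * E ^ 2 := by
          have : 0 ≤ 1 - 2 * m := by linarith
          gcongr
        have e2 : (E * (1 - m / (1 + α))) ^ 2 = (1 - 2 * m) * E ^ 2 +
            E ^ 2 * (2 * m * α / (1 + α) + m ^ 2 / (1 + α) ^ 2) := by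
          field_simp
          ring
        linarith
      linarith [hstep k hk, hR1 k]
end

section
/- Let u : ℝ → ℝⁿ be differentiable on [0,∞) with u'(t) = -∇f(u(t)) for all t ≥ 0, let u* be the unique minimizer of f, let M > 0 satisfy ‖∇f(u(t))‖ ≤ M for all t ≥ 0, and set C_E = β M^α / μ. Fix η > 0, let T = T*(η) := inf{ T ≥ 0 : ‖u(t) - u*‖ ≤ η for all t ≥ T }, and let K be a positive integer satisfying K ≥ max{ T, 4μT, MT/δ, C_E^{1/α} T / δ^{1/α}, (2β²)^{1/((1-α)²+α²)} T^{1 + 1/((1-α)²+α²)} / C_E^{2(1-α)/((1-α)²+α²)} } and K ≥ μ^{-1/α} β^{1/α} M T η^{-1/α}. Set τ = T/K and define u_0 = u(0), u_{k+1} = u_k - τ ∇f(u_k). Then ‖u_K - u(T*(η))‖ ≤ η. -/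
open Real Set RealInnerProductSpace

section GradientBounds

variable {F : Type*} [NormedAddCommGroup F] [InnerProductSpace ℝ F]

/-- Strong convexity makes the gradient strongly monotone. -/
theorem inner_sub_ge_of_strongConvex {f : F → ℝ} {g : F → F} {μ : ℝ}
    (hsc : ∀ x y, f x - f y ≥ ⟪g y, x - y⟫ + μ / 2 * ‖x - y‖ ^ 2) (x y : F) :
    μ * ‖x - y‖ ^ 2 ≤ ⟪g x - g y, x - y⟫ := by
  have h1 := hsc x y
  have h2 := hsc y x
  rw [← neg_sub x y, inner_neg_right, norm_neg] at h2
  rw [inner_sub_left]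
  linarith

theorem mul_norm_sub_le_norm_of_strongConvex {f : F → ℝ} {g : F → F} {μ : ℝ}
    (hsc : ∀ x y, f x - f y ≥ ⟪g y, x - y⟫ + μ / 2 * ‖x - y‖ ^ 2) {z : F} (hz : g z = 0)
    (x : F) : μ * ‖x - z‖ ≤ ‖g x‖ := by
  have h := inner_sub_ge_of_strongConvex hsc x z
  rw [hz, sub_zero] at h
  have h' := h.trans (real_inner_le_norm (g x) (x - z))
  rcases (norm_nonneg (x - z)).eq_or_lt with h0 | h0
  · rw [← h0]; simp
  · nlinarith

/-- One explicit gradient step from two points at distance at most `δ`. -/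
theorem norm_gradient_step_sub_sq_le {f : F → ℝ} {g : F → F} {μ α β δ τ : ℝ}
    (hsc : ∀ x y, f x - f y ≥ ⟪g y, x - y⟫ + μ / 2 * ‖x - y‖ ^ 2)
    (hH : ∀ x y, ‖x - y‖ ≤ δ → ‖g x - g y‖ ≤ β * ‖x - y‖ ^ α) (hτ : 0 ≤ τ)
    {x y : F} (hxy : ‖x - y‖ ≤ δ) :
    ‖(x - y) - τ • (g x - g y)‖ ^ 2 ≤
      (1 - 2 * (μ * τ)) * ‖x - y‖ ^ 2 + (τ * (β * ‖x - y‖ ^ α)) ^ 2 := by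
  have h1 := mul_le_mul_of_nonneg_left (inner_sub_ge_of_strongConvex hsc x y) hτ
  have h2 : (τ * ‖g x - g y‖) ^ 2 ≤ (τ * (β * ‖x - y‖ ^ α)) ^ 2 := by
    gcongr
    exact hH x y hxy
  rw [norm_sub_sq_real, inner_smul_right, norm_smul, Real.norm_of_nonneg hτ,
    real_inner_comm]
  linarith

/-- Local truncation error of the explicit Euler scheme for a gradient flow with locally Hölder
gradient and bounded speed. -/
theorem norm_euler_truncation_le {g : F → F} {α β δ M t τ : ℝ} (hα : 0 < α) (hβ : 0 ≤ β)
    (hM : 0 ≤ M) (hH : ∀ x y, ‖x - y‖ ≤ δ → ‖g x - g y‖ ≤ β * ‖x - y‖ ^ α)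
    {u : ℝ → F} (hu : ∀ s, 0 ≤ s → HasDerivAt u (-(g (u s))) s)
    (hMb : ∀ s, 0 ≤ s → ‖g (u s)‖ ≤ M) (ht : 0 ≤ t) (hτ : 0 ≤ τ) (hδ : M * τ ≤ δ) :
    ‖u (t + τ) - u t + τ • g (u t)‖ ≤ β * M ^ α * τ ^ (1 + α) / (1 + α) := by
  have hspeed : ∀ s, 0 ≤ s → ‖u (t + s) - u t‖ ≤ M * s := by
    intro s hs
    have h := (convex_Ici (0 : ℝ)).norm_image_sub_le_of_norm_hasDerivWithin_le (f := u)
      (f' := fun s => -(g (u s))) (C := M) (fun s hs => (hu s hs).hasDerivWithinAt)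
      (fun s hs => by rw [norm_neg]; exact hMb s hs) (mem_Ici.2 ht)
      (mem_Ici.2 (add_nonneg ht hs))
    rwa [add_sub_cancel_left, Real.norm_of_nonneg hs] at h
  have hw : ∀ s, 0 ≤ s → HasDerivAt (fun s => u (t + s) - u t + s • g (u t))
      (-(g (u (t + s))) + g (u t)) s := by
    intro s hs
    have h1 := ((hu (t + s) (add_nonneg ht hs)).comp_const_add t s).sub_const (u t)
    have h2 := (hasDerivAt_id s).smul_const (g (u t))
    refine (h1.add h2).congr_deriv ?_
    simp
  have hB : ∀ s : ℝ, HasDerivAt (fun s : ℝ => β * M ^ α * s ^ (1 + α) / (1 + α))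
      (β * M ^ α * s ^ α) s := by
    intro s
    have h := ((Real.hasDerivAt_rpow_const (x := s) (p := 1 + α)
      (Or.inr (by linarith))).const_mul (β * M ^ α)).div_const (1 + α)
    refine h.congr_deriv ?_
    rw [add_sub_cancel_left]
    have : 1 + α ≠ 0 := by positivity
    field_simp
  refine image_norm_le_of_norm_deriv_right_le_deriv_boundary
    (f := fun s => u (t + s) - u t + s • g (u t)) (a := 0) (b := τ)
    (fun s hs => (hw s hs.1).continuousAt.continuousWithinAt)
    (fun s hs => (hw s hs.1).hasDerivWithinAt) ?_ hB ?_ (right_mem_Icc.2 hτ)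
  · have h0 : (0 : ℝ) ^ (1 + α) = 0 := Real.zero_rpow (by positivity)
    simp [h0]
  · intro s hs
    have hs' := hspeed s hs.1
    have h1 : ‖u (t + s) - u t‖ ≤ δ :=
      hs'.trans ((mul_le_mul_of_nonneg_left hs.2.le hM).trans hδ)
    rw [neg_add_eq_sub, norm_sub_rev, mul_assoc, ← Real.mul_rpow hM hs.1]
    refine (hH _ _ h1).trans ?_
    gcongr

end GradientBounds

/-- For small Hölder exponents, the interval `[0, E]` is invariant under the Euler error
recursion. -/
theorem small_exponent_step {h α : ℝ} (hh : 0 < h) (hh4 : h ≤ 1 / 4) (hα : 0 < α)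
    (hα4 : α ≤ 1 / 4) :
    1 - 2 * h + (h / h ^ α) ^ 2 ≤ (1 - h / (1 + α)) ^ 2 := by
  obtain ⟨s, hs, rfl⟩ : ∃ s : ℝ, 0 < s ∧ h = s ^ 2 :=
    ⟨√h, Real.sqrt_pos.2 hh, (Real.sq_sqrt hh.le).symm⟩
  have hs2 : s ≤ 1 / 2 := by nlinarith
  have hbern : ((s ^ 2) ^ α)⁻¹ ^ 2 ≤ 1 + 4 * α * (s⁻¹ - 1) := by
    have h1 := rpow_one_add_le_one_add_mul_self (s := s⁻¹ - 1) (p := 4 * α)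
      (by linarith [inv_pos.2 hs]) (by positivity) (by linarith)
    rw [add_sub_cancel] at h1
    refine le_of_eq_of_le ?_ h1
    rw [Real.inv_rpow hs.le, inv_pow]
    congr 1
    rw [← Real.rpow_natCast s 2, ← Real.rpow_mul hs.le, ← Real.rpow_natCast, ← Real.rpow_mul hs.le]
    congr 1
    push_cast
    ring
  have hmain : (s ^ 2 / (s ^ 2) ^ α) ^ 2 ≤ s ^ 4 + 4 * α * (s ^ 3 - s ^ 4) := by
    calc (s ^ 2 / (s ^ 2) ^ α) ^ 2 = s ^ 4 * ((s ^ 2) ^ α)⁻¹ ^ 2 := by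
          rw [div_eq_mul_inv]; ring
      _ ≤ s ^ 4 * (1 + 4 * α * (s⁻¹ - 1)) := by gcongr
      _ = _ := by field_simp
  have hkey : s ^ 2 * (2 + α) + 4 * (s - s ^ 2) * (1 + α) ^ 2 ≤ 2 * (1 + α) := by
    have h1 : s ^ 2 ≤ 1 / 4 := hh4
    have h2 : 4 * (s - s ^ 2) ≤ 1 := by nlinarith [sq_nonneg (2 * s - 1)]
    have h3 := mul_le_mul_of_nonneg_right h1 (by linarith : 0 ≤ 2 + α)
    have h4 := mul_le_mul_of_nonneg_right h2 (sq_nonneg (1 + α))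
    nlinarith
  have hdiff : (1 - s ^ 2 / (1 + α)) ^ 2 - (1 - 2 * s ^ 2 + (s ^ 4 + 4 * α * (s ^ 3 - s ^ 4))) =
      α * s ^ 2 / (1 + α) ^ 2 *
        (2 * (1 + α) - (s ^ 2 * (2 + α) + 4 * (s - s ^ 2) * (1 + α) ^ 2)) := by
    field_simp
    ring
  have : 0 ≤ α * s ^ 2 / (1 + α) ^ 2 *
        (2 * (1 + α) - (s ^ 2 * (2 + α) + 4 * (s - s ^ 2) * (1 + α) ^ 2)) := by
    apply mul_nonneg (by positivity)
    linarith
  linarith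

/-- Squared form of the normalised Euler error recursion. -/
theorem sq_le_of_sq_le_of_le_add {h c X a b : ℝ} (hh : 0 < h) (hh4 : h ≤ 1 / 4)
    (hb0 : 0 ≤ b) (ha : a ^ 2 ≤ X) (hb : b ≤ a + h * c) :
    (1 - h) * b ^ 2 ≤ X + h * (1 - h) * c ^ 2 := by
  have h1 : b ^ 2 ≤ (a + h * c) ^ 2 := by gcongr
  have h2 : 0 ≤ h * (a - (1 - h) * c) ^ 2 := by positivity
  nlinarith

/-- One step of a rational barrier for the recursion
`(1 - h) a' ≤ (1 - 2 h) a + h / (2 S) + (16 / 25) h (1 - h)`. -/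
theorem rational_barrier_step {h x D a a' : ℝ} (hh : 0 < h) (hh4 : h ≤ 1 / 4) (hx : 0 ≤ x)
    (hD : 0 ≤ D) (ha : a ≤ D * (2 * x / (1 + 32 / 25 * x)))
    (ha' : (1 - h) * a' ≤ (1 - 2 * h) * a + h * D) :
    a' ≤ D * (2 * (x + h) / (1 + 32 / 25 * (x + h))) := by
  have hB : 0 < 1 + 32 / 25 * x := by positivity
  have hB' : 0 < 1 + 32 / 25 * (x + h) := by positivity
  have key : (1 - 2 * h) * (2 * x / (1 + 32 / 25 * x)) + h ≤
      (1 - h) * (2 * (x + h) / (1 + 32 / 25 * (x + h))) := by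
    rw [← sub_nonneg]
    have e : (1 - h) * (2 * (x + h) / (1 + 32 / 25 * (x + h))) -
        ((1 - 2 * h) * (2 * x / (1 + 32 / 25 * x)) + h) =
        h * (1 - 14 / 25 * x + 576 / 625 * x ^ 2 - h * (82 / 25 - 576 / 625 * x)) /
          ((1 + 32 / 25 * x) * (1 + 32 / 25 * (x + h))) := by
      field_simp
      ring
    rw [e]
    apply div_nonneg _ (by positivity)
    apply mul_nonneg hh.le
    nlinarith [sq_nonneg (x - 1 / 5), mul_nonneg hh.le hx]
  have h1 := mul_le_mul_of_nonneg_left ha (by linarith : 0 ≤ 1 - 2 * h)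
  have h2 := mul_le_mul_of_nonneg_left key hD
  have h3 : (1 - h) * a' ≤ (1 - h) * (D * (2 * (x + h) / (1 + 32 / 25 * (x + h)))) := by
    linarith
  exact le_of_mul_le_mul_left h3 (by linarith)

/-- If the error recursion with tolerance `E` holds as long as the error is at most `E`, then the
error stays below `E` for `K` steps. -/
theorem euler_error_le {α h E G : ℝ} {K : ℕ} {e : ℕ → ℝ} (hα : 0 < α)
    (hh : 0 < h) (hh4 : h ≤ 1 / 4) (hE : 0 < E) (hK : 0 < K) (he : ∀ k, 0 ≤ e k)
    (he0 : e 0 = 0) (hG0 : 0 ≤ G) (hG : G ≤ h / h ^ α) (hGK : 2 * K * G ^ 2 ≤ 1)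
    (hstep : ∀ k, e k ≤ E → ∃ a, a ^ 2 ≤ (1 - 2 * h) * e k ^ 2 + (G * E) ^ 2 ∧
      e (k + 1) ≤ a + h * (E / (1 + α))) :
    e K ≤ E := by
  rcases le_total α (1 / 4) with hα4 | hα4
  · suffices ∀ k, e k ≤ E from this K
    intro k
    induction k with
    | zero => rw [he0]; exact hE.le
    | succ k ih =>
      obtain ⟨a, ha, hle⟩ := hstep k ih
      have h1 : a ^ 2 ≤ ((1 - h / (1 + α)) * E) ^ 2 := by
        calc a ^ 2 ≤ (1 - 2 * h) * e k ^ 2 + (G * E) ^ 2 := ha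
          _ ≤ (1 - 2 * h) * E ^ 2 + (h / h ^ α * E) ^ 2 := by
            have : 0 ≤ 1 - 2 * h := by linarith
            have := he k
            gcongr
          _ = (1 - 2 * h + (h / h ^ α) ^ 2) * E ^ 2 := by ring
          _ ≤ (1 - h / (1 + α)) ^ 2 * E ^ 2 := by
            gcongr
            exact small_exponent_step hh hh4 hα hα4
          _ = _ := by ring
      have h2 : 0 ≤ (1 - h / (1 + α)) * E := by
        apply mul_nonneg _ hE.le
        rw [sub_nonneg, div_le_one (by positivity)]
        linarith
      have h3 := (abs_le_of_sq_le_sq' h1 h2).2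
      have h4 : (1 - h / (1 + α)) * E + h * (E / (1 + α)) = E := by ring
      linarith
  · have hK' : (0 : ℝ) < K := by exact_mod_cast hK
    have hS : 0 < K * h := by positivity
    set D : ℝ := 1 / (2 * (K * h)) + 16 / 25 with hDdef
    have hD : 0 < D := by positivity
    have hfrac : ∀ k : ℕ, k ≤ K →
        D * (2 * (k * h) / (1 + 32 / 25 * (k * h))) ≤ 1 := by
      intro k hk
      have hk' : (k : ℝ) * h ≤ K * h := by gcongr
      have hk0 : 0 ≤ (k : ℝ) * h := by positivity
      have e1 : D = (1 + 32 / 25 * (K * h)) / (2 * (K * h)) := by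
        rw [hDdef]; field_simp; ring
      rw [e1, div_mul_div_comm, div_le_one (by positivity)]
      nlinarith
    have hbar : ∀ k : ℕ, k ≤ K →
        e k ^ 2 ≤ E ^ 2 * D * (2 * (k * h) / (1 + 32 / 25 * (k * h))) := by
      intro k
      induction k with
      | zero => intro _; rw [he0]; simp
      | succ k ih =>
        intro hk
        have ihk := ih (by omega)
        have hkE : e k ≤ E := by
          have := hfrac k (by omega)
          refine abs_le_of_sq_le_sq' ?_ hE.le |>.2
          nlinarith [sq_nonneg E]
        obtain ⟨a, ha, hle⟩ := hstep k hkE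
        have h1 := sq_le_of_sq_le_of_le_add hh hh4 (he (k + 1)) ha hle
        have hc : (E / (1 + α)) ^ 2 ≤ 16 / 25 * E ^ 2 := by
          have : E / (1 + α) ≤ 4 / 5 * E := by
            rw [div_le_iff₀ (by positivity)]
            nlinarith
          calc (E / (1 + α)) ^ 2 ≤ (4 / 5 * E) ^ 2 := by gcongr
            _ = _ := by ring
        have hGE : (G * E) ^ 2 ≤ h * (E ^ 2 * (1 / (2 * (K * h)))) := by
          have e1 : h * (E ^ 2 * (1 / (2 * (K * h)))) = 1 / (2 * K) * E ^ 2 := by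
            field_simp
          rw [e1, mul_pow]
          gcongr
          rw [le_div_iff₀ (by positivity)]
          linarith
        have hcc : h * (1 - h) * (E / (1 + α)) ^ 2 ≤ h * (16 / 25 * E ^ 2) := by
          have h5 : h * (1 - h) ≤ h := by nlinarith
          calc h * (1 - h) * (E / (1 + α)) ^ 2 ≤ h * (E / (1 + α)) ^ 2 := by gcongr
            _ ≤ _ := by gcongr
        have h6 : (1 - h) * e (k + 1) ^ 2 ≤ (1 - 2 * h) * e k ^ 2 + h * (E ^ 2 * D) := by
          rw [hDdef]
          linarith
        have := rational_barrier_step hh hh4 (by positivity : 0 ≤ (k : ℝ) * h)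
          (by positivity) ihk h6
        rwa [show ((k + 1 : ℕ) : ℝ) * h = k * h + h by push_cast; ring]
    have h1 := hbar K le_rfl
    have h2 := hfrac K le_rfl
    refine abs_le_of_sq_le_sq' ?_ hE.le |>.2
    nlinarith [sq_nonneg E]

theorem mul_rpow_le_of_rpow_one_div_mul_le {C τ δ α : ℝ} (hC : 0 ≤ C) (hτ : 0 ≤ τ) (hδ : 0 ≤ δ)
    (hα : 0 < α) (h : C ^ (1 / α) * τ ≤ δ ^ (1 / α)) : C * τ ^ α ≤ δ := by
  have h1 := Real.rpow_le_rpow (by positivity) h hα.le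
  rwa [Real.mul_rpow (by positivity) hτ, ← Real.rpow_mul hC, ← Real.rpow_mul hδ,
    one_div_mul_cancel hα.ne', Real.rpow_one, Real.rpow_one] at h1

theorem mul_step_le_of_rpow_mul_div_le {α Y C T κ τ : ℝ} (hY : 0 < Y) (hC : 0 < C)
    (hT : 0 < T) (hκ : 0 < κ) (hτ : τ = T / κ)
    (h : Y ^ (1 / ((1 - α) ^ 2 + α ^ 2)) * T ^ (1 + 1 / ((1 - α) ^ 2 + α ^ 2)) /
      C ^ (2 * (1 - α) / ((1 - α) ^ 2 + α ^ 2)) ≤ κ) :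
    Y * T * τ ≤ (C * τ ^ α) ^ (2 * (1 - α)) := by
  set p : ℝ := (1 - α) ^ 2 + α ^ 2 with hp
  have hp0 : 0 < p := by nlinarith [sq_nonneg (2 * α - 1)]
  have hτ0 : 0 < τ := by rw [hτ]; positivity
  have h1 : Y ^ (1 / p) * T ^ (1 / p) * τ ≤ C ^ (2 * (1 - α) / p) := by
    rw [Real.rpow_add hT, Real.rpow_one, div_le_iff₀ (by positivity)] at h
    rw [hτ, mul_div_assoc', div_le_iff₀ hκ]
    linarith
  have h2 := Real.rpow_le_rpow (by positivity) h1 hp0.le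
  rw [Real.mul_rpow (by positivity) hτ0.le, Real.mul_rpow (by positivity) (by positivity),
    ← Real.rpow_mul hY.le, ← Real.rpow_mul hT.le, ← Real.rpow_mul hC.le,
    one_div_mul_cancel hp0.ne', div_mul_cancel₀ _ hp0.ne', Real.rpow_one, Real.rpow_one] at h2
  have h3 : τ = τ ^ p * τ ^ (α * (2 * (1 - α))) := by
    rw [← Real.rpow_add hτ0, hp]
    ring_nf
    simp
  calc Y * T * τ = Y * T * τ ^ p * τ ^ (α * (2 * (1 - α))) := by rw [mul_assoc _ (τ ^ p), ← h3]
    _ ≤ C ^ (2 * (1 - α)) * τ ^ (α * (2 * (1 - α))) := by gcongr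
    _ = _ := by rw [Real.mul_rpow hC.le (by positivity), ← Real.rpow_mul hτ0.le]

theorem gradient_eq_zero_of_forall_le {F : Type*} [NormedAddCommGroup F] [InnerProductSpace ℝ F]
    [CompleteSpace F] {f : F → ℝ} {z : F} (h : ∀ y, f z ≤ f y) : gradient f z = 0 := by
  have hz : IsLocalMin f z := Filter.Eventually.of_forall h
  simp [gradient, hz.fderiv_eq_zero]

/-- Basic complexity result: if `T = T*(η)` and the number of Euler steps `K` is large enough
(so that in particular `K ≥ μ^{-1/α} β^{1/α} M T η^{-1/α}`), then the `K`-th forward Euler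
iterate with stepsize `τ = T/K` satisfies `‖u_K - u(T*(η))‖ ≤ η`. -/
theorem euler_reaches_target
    {n : ℕ} (f : EuclideanSpace ℝ (Fin n) → ℝ) (μ : ℝ) (hμ : 0 < μ)
    (hf : ContDiff ℝ 1 f)
    (hsc : ∀ x y : EuclideanSpace ℝ (Fin n),
      f x - f y ≥ ⟪gradient f y, x - y⟫ + μ / 2 * ‖x - y‖ ^ 2)
    (α β δ : ℝ) (hα : 0 < α) (hα1 : α ≤ 1) (hβ : 0 < β) (hδ : 0 < δ)
    (hH : ∀ x y : EuclideanSpace ℝ (Fin n),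
      ‖x - y‖ ≤ δ → ‖gradient f x - gradient f y‖ ≤ β * ‖x - y‖ ^ α)
    (u : ℝ → EuclideanSpace ℝ (Fin n))
    (hu : ∀ t : ℝ, 0 ≤ t → HasDerivAt u (-(gradient f (u t))) t)
    (ustar : EuclideanSpace ℝ (Fin n))
    (hmin : ∀ y, f ustar ≤ f y)
    (huniq : ∀ y, (∀ z, f y ≤ f z) → y = ustar)
    (M : ℝ) (hM : 0 < M)
    (hMb : ∀ t : ℝ, 0 ≤ t → ‖gradient f (u t)‖ ≤ M)
    (C_E : ℝ) (hCE : C_E = β * M ^ α / μ)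
    (η : ℝ) (hη : 0 < η)
    (T : ℝ) (hT : T = sInf {T' : ℝ | 0 ≤ T' ∧ ∀ t : ℝ, T' ≤ t → ‖u t - ustar‖ ≤ η})
    (K : ℕ) (hK0 : 0 < K)
    (hK : (K : ℝ) ≥ max (max (max (max T (4 * μ * T)) (M * T / δ))
        (C_E ^ (1 / α) * T / δ ^ (1 / α)))
        ((2 * β ^ 2) ^ (1 / ((1 - α) ^ 2 + α ^ 2)) * T ^ (1 + 1 / ((1 - α) ^ 2 + α ^ 2)) /
          C_E ^ (2 * (1 - α) / ((1 - α) ^ 2 + α ^ 2))))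
    (hK' : (K : ℝ) ≥ μ ^ (-(1 / α)) * β ^ (1 / α) * M * T * η ^ (-(1 / α)))
    (τ : ℝ) (hτ : τ = T / K)
    (uk : ℕ → EuclideanSpace ℝ (Fin n)) (huk0 : uk 0 = u 0)
    (hukrec : ∀ k : ℕ, uk (k + 1) = uk k - τ • gradient f (uk k)) :
    ‖uk K - u T‖ ≤ η := by
  have hz := gradient_eq_zero_of_forall_le hmin
  have hdist : ∀ t : ℝ, 0 ≤ t → ‖u t - ustar‖ ≤ M / μ := by
    intro t ht
    rw [le_div_iff₀ hμ, mul_comm]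
    exact (mul_norm_sub_le_norm_of_strongConvex hsc hz (u t)).trans (hMb t ht)
  have hT0 : 0 ≤ T := by
    rw [hT]
    exact Real.sInf_nonneg fun x hx => hx.1
  rcases hT0.eq_or_lt with hTz | hTpos
  · have huk : ∀ k, uk k = u 0 := by
      intro k
      induction k with
      | zero => exact huk0
      | succ k ih => rw [hukrec, ih, hτ, ← hTz]; simp
    rw [huk, ← hTz]
    simpa using hη.le
  have hηM : η < M / μ := by
    by_contra! hle
    refine hTpos.not_ge ?_
    rw [hT]
    exact csInf_le ⟨0, fun x hx => hx.1⟩ ⟨le_rfl, fun t ht => (hdist t ht).trans hle⟩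
  have hKpos : (0 : ℝ) < K := by exact_mod_cast hK0
  have hτ0 : 0 < τ := by rw [hτ]; positivity
  have hKτ : K * τ = T := by rw [hτ]; field_simp
  simp only [ge_iff_le, max_le_iff] at hK
  obtain ⟨⟨⟨⟨-, hK2⟩, hK3⟩, hK4⟩, hK5⟩ := hK
  have hC : 0 < C_E := by rw [hCE]; positivity
  have hh4 : μ * τ ≤ 1 / 4 := by
    rw [hτ, mul_div_assoc', div_le_iff₀ hKpos]
    linarith
  have hMτ : M * τ ≤ δ := by
    rw [div_le_iff₀ hδ] at hK3
    rw [hτ, mul_div_assoc', div_le_iff₀ hKpos]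
    linarith
  have hEδ : C_E * τ ^ α ≤ δ := by
    apply mul_rpow_le_of_rpow_one_div_mul_le hC.le hτ0.le hδ.le hα
    rw [div_le_iff₀ (by positivity)] at hK4
    rw [hτ, mul_div_assoc', div_le_iff₀ hKpos]
    linarith
  have hEη : C_E * τ ^ α ≤ η := by
    apply mul_rpow_le_of_rpow_one_div_mul_le hC.le hτ0.le hη.le hα
    have e1 : C_E ^ (1 / α) = μ ^ (-(1 / α)) * β ^ (1 / α) * M := by
      rw [hCE, Real.div_rpow (by positivity) hμ.le, Real.mul_rpow hβ.le (by positivity),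
        ← Real.rpow_mul hM.le, mul_one_div_cancel hα.ne', Real.rpow_one, Real.rpow_neg hμ.le]
      ring
    rw [ge_iff_le, Real.rpow_neg hη.le, ← div_eq_mul_inv, div_le_iff₀ (by positivity),
      ← e1] at hK'
    rw [hτ, mul_div_assoc', div_le_iff₀ hKpos]
    linarith
  have hfine := mul_step_le_of_rpow_mul_div_le (by positivity) hC hTpos hKpos hτ hK5
  set E : ℝ := C_E * τ ^ α with hEdef
  have hE : 0 < E := by positivity
  have hμE : μ * E = β * (M * τ) ^ α := by
    rw [hEdef, hCE, Real.mul_rpow hM.le hτ0.le]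
    field_simp
  have hEM : E * μ ≤ M := (le_div_iff₀ hμ).1 (hEη.trans hηM.le)
  have hG : τ * (β * E ^ α) / E ≤ μ * τ / (μ * τ) ^ α := by
    rw [div_le_div_iff₀ hE (by positivity)]
    have h1 : E ^ α * (μ * τ) ^ α ≤ (M * τ) ^ α := by
      rw [← Real.mul_rpow hE.le (by positivity), ← mul_assoc]
      gcongr
    calc τ * (β * E ^ α) * (μ * τ) ^ α = τ * β * (E ^ α * (μ * τ) ^ α) := by ring
      _ ≤ τ * β * (M * τ) ^ α := by gcongr
      _ = τ * (μ * E) := by rw [hμE]; ring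
      _ = _ := by ring
  have hGK : 2 * K * (τ * (β * E ^ α) / E) ^ 2 ≤ 1 := by
    rw [div_pow, mul_div_assoc', div_le_one (by positivity)]
    calc 2 * K * (τ * (β * E ^ α)) ^ 2 = 2 * β ^ 2 * (K * τ) * τ * (E ^ α) ^ 2 := by ring
      _ ≤ E ^ (2 * (1 - α)) * (E ^ α) ^ 2 := by rw [hKτ]; gcongr
      _ = E ^ 2 := by
        rw [← Real.rpow_natCast (E ^ α), ← Real.rpow_mul hE.le, ← Real.rpow_add hE,
          ← Real.rpow_natCast E]
        congr 1
        push_cast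
        ring
  have hmain := euler_error_le (e := fun k : ℕ => ‖uk k - u (k * τ)‖) hα
    (by positivity : 0 < μ * τ) hh4 hE hK0 (fun k => norm_nonneg _) (by simp [huk0])
    (by positivity) hG hGK ?_
  · simp only [hKτ] at hmain
    exact hmain.trans hEη
  · intro k hk
    have ht : 0 ≤ (k : ℝ) * τ := by positivity
    refine ⟨‖(uk k - u (k * τ)) - τ • (gradient f (uk k) - gradient f (u (k * τ)))‖, ?_, ?_⟩
    · refine (norm_gradient_step_sub_sq_le hsc hH hτ0.le (hk.trans hEδ)).trans ?_
      rw [div_mul_cancel₀ _ hE.ne']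
      gcongr
    · have htr := norm_euler_truncation_le hα hβ.le hM.le hH hu hMb ht hτ0.le hMτ
      have e1 : β * M ^ α * τ ^ (1 + α) / (1 + α) = μ * τ * (E / (1 + α)) := by
        rw [Real.rpow_add hτ0, Real.rpow_one, mul_div_assoc', mul_right_comm μ, hμE,
          Real.mul_rpow hM.le hτ0.le]
        ring
      rw [e1] at htr
      have e2 : uk (k + 1) - u ((k + 1 : ℕ) * τ) =
          ((uk k - u (k * τ)) - τ • (gradient f (uk k) - gradient f (u (k * τ)))) -
            (u (k * τ + τ) - u (k * τ) + τ • gradient f (u (k * τ))) := by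
        rw [hukrec, show ((k + 1 : ℕ) : ℝ) * τ = k * τ + τ by push_cast; ring, smul_sub]
        abel
      rw [e2]
      exact (norm_sub_le _ _).trans (by gcongr)
end

section
/- Let u : ℝ → ℝⁿ be differentiable on [0,∞) with u'(t) = -∇f(u(t)) for all t ≥ 0, let u* be the unique minimizer of f, and let M > 0 satisfy ‖∇f(u(t))‖ ≤ M for all t ≥ 0. There exists ε₀ > 0 such that for every ε ∈ (0, ε₀), the gradient descent iteration u_0 = u(0), u_{k+1} = u_k - τ ∇f(u_k) with fixed stepsize τ = 2^{-1/α} μ^{1/α} β^{-1/α} M^{-1} ε^{1/α} produces, within at most ⌈ 2^{1/α} μ^{-1-1/α} β^{1/α} M log(2‖u_0 - u*‖/ε) ε^{-1/α} ⌉ iterations, an iterate u_k satisfying ‖u_k - u*‖ ≤ ε. -/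
open Real Set RealInnerProductSpace

/-- One step of gradient descent for a strongly convex function: if the gradient changes by at
most `P` over the step, the squared distance to a critical point contracts up to an error
`τ ^ 2 * P ^ 2`. -/
theorem gradient_step_sq_dist_le {E : Type*} [NormedAddCommGroup E] [InnerProductSpace ℝ E]
    {f : E → ℝ} {g : E → E} {μ τ P : ℝ} (hμ : 0 ≤ μ) (hτ : 0 ≤ τ)
    (hsc : ∀ x y : E, f x - f y ≥ ⟪g y, x - y⟫ + μ / 2 * ‖x - y‖ ^ 2)
    {z x y : E} (hz : g z = 0) (hy : y = x - τ • g x) (hP : ‖g y - g x‖ ≤ P) :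
    (1 + μ * τ) * ‖y - z‖ ^ 2 ≤ (1 - μ * τ) * ‖x - z‖ ^ 2 + τ ^ 2 * P ^ 2 := by
  have h1 := hsc z x
  have h2 := hsc x y
  have h3 := hsc y z
  have hxy : x - y = τ • g x := by rw [hy]; abel
  have hyz : y - z = (x - z) - τ • g x := by rw [hy]; abel
  have hexp : ‖y - z‖ ^ 2 = ‖x - z‖ ^ 2 - 2 * (τ * ⟪g x, x - z⟫) + τ ^ 2 * ‖g x‖ ^ 2 := by
    rw [hyz, norm_sub_sq_real, inner_smul_right, real_inner_comm, norm_smul, mul_pow,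
      Real.norm_eq_abs, sq_abs]
  have hneg : ⟪g x, z - x⟫ = -⟪g x, x - z⟫ := by rw [← inner_neg_right, neg_sub]
  have hcross : ⟪g y, g x⟫ ≥ ‖g x‖ ^ 2 - P * ‖g x‖ := by
    have h := neg_le_of_abs_le (abs_real_inner_le_norm (g y - g x) (g x))
    rw [inner_sub_left, real_inner_self_eq_norm_sq] at h
    nlinarith [norm_nonneg (g x)]
  rw [hneg, norm_sub_rev] at h1
  rw [hxy, inner_smul_right, norm_smul, mul_pow, Real.norm_eq_abs, sq_abs] at h2
  rw [hz, inner_zero_left] at h3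
  have k1 : 0 ≤ τ * (f z - f x + ⟪g x, x - z⟫ - μ / 2 * ‖x - z‖ ^ 2) :=
    mul_nonneg hτ (by linarith)
  have hquad : 0 ≤ μ / 2 * (τ ^ 2 * ‖g x‖ ^ 2) := by positivity
  have k2 : 0 ≤ τ * (f x - f y - τ * ⟪g y, g x⟫) := mul_nonneg hτ (by linarith)
  have k3 : 0 ≤ τ * (f y - f z - μ / 2 * ‖y - z‖ ^ 2) := mul_nonneg hτ (by linarith)
  have k4 : 0 ≤ τ ^ 2 * (⟪g y, g x⟫ - (‖g x‖ ^ 2 - P * ‖g x‖)) :=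
    mul_nonneg (sq_nonneg _) (by linarith)
  have k5 : 0 ≤ τ ^ 2 * (‖g x‖ - P) ^ 2 := by positivity
  linarith

theorem one_sub_le_one_add_mul_exp_neg {x : ℝ} (hx : 0 ≤ x) :
    1 - x ≤ (1 + x) * Real.exp (-(2 * x)) := by
  rcases lt_or_ge x 1 with hx1 | hx1
  · have h := Real.sum_range_le_log_div hx hx1 1
    have hpos : 0 < 1 - x := by linarith
    have h2 : 2 * x ≤ Real.log ((1 + x) / (1 - x)) := by
      norm_num at h
      linarith
    have h3 := (Real.le_log_iff_exp_le (by positivity)).1 h2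
    rw [le_div_iff₀ hpos] at h3
    rw [Real.exp_neg, ← div_eq_mul_inv, le_div_iff₀ (Real.exp_pos _)]
    linarith
  · have : 0 ≤ (1 + x) * Real.exp (-(2 * x)) := by positivity
    linarith

/-- Gradient descent for a strongly convex function converges linearly to a critical point, up to
an error controlled by the change `P` of the gradient over a single step. -/
theorem gradient_descent_sq_dist_le {E : Type*} [NormedAddCommGroup E] [InnerProductSpace ℝ E]
    {f : E → ℝ} {g : E → E} {μ τ P S R : ℝ} (hμ : 0 ≤ μ) (hτ : 0 ≤ τ) (hμτ : μ * τ ≤ 1)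
    (hsc : ∀ x y : E, f x - f y ≥ ⟪g y, x - y⟫ + μ / 2 * ‖x - y‖ ^ 2)
    {z : E} (hz : g z = 0) {x : ℕ → E} (hx : ∀ k, x (k + 1) = x k - τ • g (x k))
    (hP : ∀ y : E, ‖y - z‖ ^ 2 ≤ R → ‖g (y - τ • g y) - g y‖ ≤ P)
    (hS : 0 ≤ S) (hPS : τ * P ^ 2 ≤ 2 * μ * S) (hR : ‖x 0 - z‖ ^ 2 + S ≤ R) (k : ℕ) :
    ‖x k - z‖ ^ 2 ≤ Real.exp (-(2 * (μ * τ) * k)) * ‖x 0 - z‖ ^ 2 + S := by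
  induction k with
  | zero => simpa using hS
  | succ k ih =>
    have hmt : 0 ≤ μ * τ := mul_nonneg hμ hτ
    have hle : Real.exp (-(2 * (μ * τ) * k)) * ‖x 0 - z‖ ^ 2 ≤ ‖x 0 - z‖ ^ 2 :=
      mul_le_of_le_one_left (sq_nonneg _) (Real.exp_le_one_iff.2 (by
        have : 0 ≤ 2 * (μ * τ) * k := by positivity
        linarith))
    have hstep := gradient_step_sq_dist_le hμ hτ hsc hz (hx k)
      ((hx k).symm ▸ hP (x k) (by linarith))
    have hexp : Real.exp (-(2 * (μ * τ) * (k + 1 : ℕ))) =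
        Real.exp (-(2 * (μ * τ))) * Real.exp (-(2 * (μ * τ) * k)) := by
      rw [← Real.exp_add]
      push_cast
      ring_nf
    have h1 := mul_le_mul_of_nonneg_left ih (sub_nonneg.2 hμτ)
    have h2 := mul_le_mul_of_nonneg_right (one_sub_le_one_add_mul_exp_neg hmt)
      (by positivity : 0 ≤ Real.exp (-(2 * (μ * τ) * k)) * ‖x 0 - z‖ ^ 2)
    have h3 := mul_le_mul_of_nonneg_left hPS hτ
    rw [hexp]
    refine le_of_mul_le_mul_left ?_ (by linarith : 0 < 1 + μ * τ)
    linarith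

theorem exists_norm_gradient_le_of_sq_dist_le {n : ℕ} {f : EuclideanSpace ℝ (Fin n) → ℝ}
    (hf : ContDiff ℝ 1 f) (z : EuclideanSpace ℝ (Fin n)) (R : ℝ) :
    ∃ G : ℝ, 0 < G ∧ ∀ y, ‖y - z‖ ^ 2 ≤ R → ‖gradient f y‖ ≤ G := by
  have hcont : Continuous (gradient f) :=
    (InnerProductSpace.toDual ℝ _).symm.continuous.comp (hf.continuous_fderiv one_ne_zero)
  obtain ⟨C, hC⟩ := (isCompact_closedBall z (√R)).exists_bound_of_continuousOn hcont.continuousOn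
  refine ⟨max C 1, by positivity, fun y hy ↦ (hC y ?_).trans (le_max_left _ _)⟩
  rw [mem_closedBall_iff_norm]
  exact Real.le_sqrt_of_sq_le hy

/-- Basic complexity result for gradient descent with fixed stepsize
`τ = 2^{-1/α} μ^{1/α} β^{-1/α} M^{-1} ε^{1/α}`: for all sufficiently small `ε > 0`, within at
most `⌈2^{1/α} μ^{-1-1/α} β^{1/α} M log(2‖u₀ - u*‖/ε) ε^{-1/α}⌉` iterations the method reaches
an iterate with `‖u_k - u*‖ ≤ ε`. -/
theorem gradient_descent_basic_complexity
    {n : ℕ} (f : EuclideanSpace ℝ (Fin n) → ℝ) (μ : ℝ) (hμ : 0 < μ)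
    (hf : ContDiff ℝ 1 f)
    (hsc : ∀ x y : EuclideanSpace ℝ (Fin n),
      f x - f y ≥ ⟪gradient f y, x - y⟫ + μ / 2 * ‖x - y‖ ^ 2)
    (α β δ : ℝ) (hα : 0 < α) (hα1 : α ≤ 1) (hβ : 0 < β) (hδ : 0 < δ)
    (hH : ∀ x y : EuclideanSpace ℝ (Fin n),
      ‖x - y‖ ≤ δ → ‖gradient f x - gradient f y‖ ≤ β * ‖x - y‖ ^ α)
    (u : ℝ → EuclideanSpace ℝ (Fin n))
    (hu : ∀ t : ℝ, 0 ≤ t → HasDerivAt u (-(gradient f (u t))) t)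
    (ustar : EuclideanSpace ℝ (Fin n))
    (hmin : ∀ y, f ustar ≤ f y)
    (huniq : ∀ y, (∀ z, f y ≤ f z) → y = ustar)
    (M : ℝ) (hM : 0 < M)
    (hMb : ∀ t : ℝ, 0 ≤ t → ‖gradient f (u t)‖ ≤ M) :
    ∃ ε₀ : ℝ, 0 < ε₀ ∧ ∀ ε : ℝ, 0 < ε → ε < ε₀ →
      ∀ uk : ℕ → EuclideanSpace ℝ (Fin n), uk 0 = u 0 →
        (∀ k : ℕ, uk (k + 1) = uk k -
          ((2 : ℝ) ^ (-(1 / α)) * μ ^ (1 / α) * β ^ (-(1 / α)) * M⁻¹ * ε ^ (1 / α)) •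
            gradient f (uk k)) →
        ∃ k : ℕ, k ≤ ⌈(2 : ℝ) ^ (1 / α) * μ ^ (-1 - 1 / α) * β ^ (1 / α) * M *
            Real.log (2 * ‖u 0 - ustar‖ / ε) * ε ^ (-(1 / α))⌉₊ ∧
          ‖uk k - ustar‖ ≤ ε := by
  have hz : gradient f ustar = 0 := by
    have h : fderiv ℝ f ustar = 0 :=
      IsLocalMin.fderiv_eq_zero (Filter.Eventually.of_forall hmin)
    simp [gradient, h]
  obtain ⟨G, hG, hGb⟩ := exists_norm_gradient_le_of_sq_dist_le hf ustar (‖u 0 - ustar‖ ^ 2 + 1)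
  set c : ℝ := (2 : ℝ) ^ (-(1 / α)) * μ ^ (1 / α) * β ^ (-(1 / α)) * M⁻¹ with hc
  have hcpos : 0 < c := by positivity
  set C : ℝ := β * (c * G) ^ α with hC
  have hCpos : 0 < C := by positivity
  -- every smallness condition on the stepsize is of the form `τ ≤ η`
  set η : ℝ := min (1 / μ) (min (δ / G) (3 / 2 * μ / C ^ 2)) with hη
  have hηpos : 0 < η := by positivity
  have htend : Filter.Tendsto (fun ε : ℝ ↦ c * ε ^ (1 / α)) (nhds 0) (nhds 0) := by
    have h : ContinuousAt (fun ε : ℝ ↦ c * ε ^ (1 / α)) 0 :=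
      continuousAt_const.mul (Real.continuousAt_rpow_const _ _ (Or.inr (by positivity)))
    have h0 : c * (0 : ℝ) ^ (1 / α) = 0 := by
      rw [Real.zero_rpow (by positivity), mul_zero]
    simpa only [ContinuousAt, h0] using h
  obtain ⟨r, hr, hrη⟩ := Metric.eventually_nhds_iff.1 (htend.eventually_lt_const hηpos)
  refine ⟨min r 1, by positivity, fun ε hε hε0 uk h0 hk ↦ ?_⟩
  have hε1 : ε < 1 := hε0.trans_le (min_le_right _ _)
  have hτη : c * ε ^ (1 / α) < η := hrη (by
    rw [Real.dist_eq, sub_zero, abs_of_pos hε]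
    exact hε0.trans_le (min_le_left _ _))
  have hcount : (2 : ℝ) ^ (1 / α) * μ ^ (-1 - 1 / α) * β ^ (1 / α) * M *
      Real.log (2 * ‖u 0 - ustar‖ / ε) * ε ^ (-(1 / α)) =
      Real.log (2 * ‖u 0 - ustar‖ / ε) / (μ * (c * ε ^ (1 / α))) := by
    rw [hc, Real.rpow_sub hμ, Real.rpow_neg_one, Real.rpow_neg hβ.le, Real.rpow_neg hε.le,
      Real.rpow_neg zero_le_two]
    field_simp
  have hPval : β * ((c * ε ^ (1 / α)) * G) ^ α = C * ε := by
    rw [hC, show (c * ε ^ (1 / α)) * G = (c * G) * ε ^ (1 / α) by ring,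
      Real.mul_rpow (by positivity) (by positivity), ← Real.rpow_mul hε.le,
      one_div_mul_cancel hα.ne', Real.rpow_one]
    ring
  rw [hcount]
  set τ : ℝ := c * ε ^ (1 / α) with hτ
  have hτpos : 0 < τ := by positivity
  have hτμ : μ * τ ≤ 1 := by
    have h := hτη.le.trans (min_le_left _ _)
    rw [le_div_iff₀ hμ] at h
    linarith
  have hτG : τ * G ≤ δ :=
    (le_div_iff₀ hG).1 (hτη.le.trans ((min_le_right _ _).trans (min_le_left _ _)))
  have hτC : τ * C ^ 2 ≤ 3 / 2 * μ :=
    (le_div_iff₀ (by positivity)).1 (hτη.le.trans ((min_le_right _ _).trans (min_le_right _ _)))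
  have hP : ∀ y, ‖y - ustar‖ ^ 2 ≤ ‖u 0 - ustar‖ ^ 2 + 1 →
      ‖gradient f (y - τ • gradient f y) - gradient f y‖ ≤ C * ε := by
    intro y hy
    have hnorm : ‖(y - τ • gradient f y) - y‖ ≤ τ * G := by
      rw [sub_sub_cancel_left, norm_neg, norm_smul, Real.norm_of_nonneg hτpos.le]
      exact mul_le_mul_of_nonneg_left (hGb y hy) hτpos.le
    refine (hH _ _ (hnorm.trans hτG)).trans ?_
    rw [← hPval]
    gcongr
  have hbound := gradient_descent_sq_dist_le (S := 3 / 4 * ε ^ 2) hμ.le hτpos.le hτμ hsc hz hk hP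
    (by positivity) (by nlinarith [mul_le_mul_of_nonneg_right hτC (sq_nonneg ε)])
    (by rw [h0]; nlinarith)
  rw [h0] at hbound
  rcases (norm_nonneg (u 0 - ustar)).eq_or_lt with hd | hd
  · exact ⟨0, Nat.zero_le _, by rw [h0, ← hd]; exact hε.le⟩
  refine ⟨_, le_rfl, ?_⟩
  set K := ⌈Real.log (2 * ‖u 0 - ustar‖ / ε) / (μ * τ)⌉₊ with hK
  have hKle : Real.log (2 * ‖u 0 - ustar‖ / ε) ≤ μ * τ * K := by
    have h := Nat.le_ceil (Real.log (2 * ‖u 0 - ustar‖ / ε) / (μ * τ))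
    rw [div_le_iff₀ (by positivity)] at h
    linarith
  have hexp : Real.exp (-(μ * τ * K)) * ‖u 0 - ustar‖ ≤ ε / 2 := by
    have h := (Real.log_le_iff_le_exp (by positivity)).1 hKle
    rw [div_le_iff₀ hε] at h
    rw [Real.exp_neg, inv_mul_le_iff₀ (Real.exp_pos _)]
    linarith
  have hsq : Real.exp (-(2 * (μ * τ) * K)) * ‖u 0 - ustar‖ ^ 2 =
      (Real.exp (-(μ * τ * K)) * ‖u 0 - ustar‖) ^ 2 := by
    rw [mul_pow, ← Real.exp_nat_mul]
    push_cast
    ring_nf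
  have hfin := hbound K
  rw [hsq] at hfin
  have hpow := pow_le_pow_left₀ (by positivity) hexp 2
  exact le_of_sq_le_sq (by linarith) hε.le
end

section
/- Let u* be the unique minimizer of f, let ε > 0 satisfy μ² β^{-2} ε^{2-2α} < 1, set τ = μ β^{-2} ε^{2-2α}, and let u ∈ ℝⁿ satisfy ε < ‖u - u*‖ ≤ δ. Then the gradient descent step satisfies ‖(u - τ ∇f(u)) - u*‖² ≤ (1 - μ² β^{-2} ε^{2-2α}) ‖u - u*‖²; in particular ‖(u - τ∇f(u)) - u*‖ ≤ ‖u - u*‖ ≤ δ. -/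
open Real Set RealInnerProductSpace

/-- Strong convexity makes the gradient coercive around a critical point. -/
theorem mul_norm_sub_sq_le_inner_gradient {F : Type*} [NormedAddCommGroup F]
    [InnerProductSpace ℝ F] [CompleteSpace F] {f : F → ℝ} {μ : ℝ}
    (hsc : ∀ x y : F, f x - f y ≥ ⟪gradient f y, x - y⟫ + μ / 2 * ‖x - y‖ ^ 2)
    {a : F} (ha : gradient f a = 0) (x : F) :
    μ * ‖x - a‖ ^ 2 ≤ ⟪gradient f x, x - a⟫ := by
  have h₁ := hsc x a
  have h₂ := hsc a x
  rw [ha, inner_zero_left] at h₁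
  rw [← neg_sub x a, inner_neg_right, norm_neg] at h₂
  linarith

theorem Real.rpow_two_sub_mul_sq_rpow_le {ε d α : ℝ} (hε : 0 < ε) (hεd : ε ≤ d) (hα : α ≤ 1) :
    ε ^ (2 - 2 * α) * (d ^ α) ^ 2 ≤ d ^ 2 := by
  have hd : 0 < d := hε.trans_le hεd
  calc ε ^ (2 - 2 * α) * (d ^ α) ^ 2 ≤ d ^ (2 - 2 * α) * (d ^ α) ^ 2 := by
        gcongr
        linarith
    _ = d ^ 2 := by
        rw [← Real.rpow_mul_natCast hd.le, ← Real.rpow_add hd, ← Real.rpow_natCast d 2]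
        congr 1
        push_cast
        ring

/-- One-step decrease of the gradient descent method with stepsize `τ = μ β^{-2} ε^{2-2α}`:
if `ε < ‖u - u*‖ ≤ δ`, then
`‖(u - τ∇f(u)) - u*‖² ≤ (1 - μ² β^{-2} ε^{2-2α}) ‖u - u*‖²`, and in particular
`‖(u - τ∇f(u)) - u*‖ ≤ ‖u - u*‖ ≤ δ`. -/
theorem gradient_descent_one_step_decrease
    {n : ℕ} (f : EuclideanSpace ℝ (Fin n) → ℝ) (μ : ℝ) (hμ : 0 < μ)
    (hf : ContDiff ℝ 1 f)
    (hsc : ∀ x y : EuclideanSpace ℝ (Fin n),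
      f x - f y ≥ ⟪gradient f y, x - y⟫ + μ / 2 * ‖x - y‖ ^ 2)
    (α β δ : ℝ) (hα : 0 < α) (hα1 : α ≤ 1) (hβ : 0 < β) (hδ : 0 < δ)
    (hH : ∀ x y : EuclideanSpace ℝ (Fin n),
      ‖x - y‖ ≤ δ → ‖gradient f x - gradient f y‖ ≤ β * ‖x - y‖ ^ α)
    (ustar : EuclideanSpace ℝ (Fin n))
    (hmin : ∀ y, f ustar ≤ f y)
    (huniq : ∀ y, (∀ z, f y ≤ f z) → y = ustar)
    (ε : ℝ) (hε : 0 < ε) (hε1 : μ ^ 2 * β ^ (-(2 : ℝ)) * ε ^ (2 - 2 * α) < 1)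
    (τ : ℝ) (hτ : τ = μ * β ^ (-(2 : ℝ)) * ε ^ (2 - 2 * α))
    (x : EuclideanSpace ℝ (Fin n)) (hx1 : ε < ‖x - ustar‖) (hx2 : ‖x - ustar‖ ≤ δ) :
    ‖(x - τ • gradient f x) - ustar‖ ^ 2 ≤
        (1 - μ ^ 2 * β ^ (-(2 : ℝ)) * ε ^ (2 - 2 * α)) * ‖x - ustar‖ ^ 2 ∧
      ‖(x - τ • gradient f x) - ustar‖ ≤ ‖x - ustar‖ ∧ ‖x - ustar‖ ≤ δ := by
  have hgrad : gradient f ustar = 0 :=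
    IsLocalMin.gradient_eq_zero (Filter.Eventually.of_forall hmin)
  have hcoer : μ * ‖x - ustar‖ ^ 2 ≤ ⟪gradient f x, x - ustar⟫ :=
    mul_norm_sub_sq_le_inner_gradient hsc hgrad x
  have hnorm : ‖gradient f x‖ ≤ β * ‖x - ustar‖ ^ α := by
    simpa [hgrad] using hH x ustar hx2
  have hpow := Real.rpow_two_sub_mul_sq_rpow_le hε hx1.le hα1
  have hβ2 : β ^ (-(2 : ℝ)) = (β ^ 2)⁻¹ := by
    rw [Real.rpow_neg hβ.le, Real.rpow_two]
  have hτ0 : 0 ≤ τ := by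
    rw [hτ]
    positivity
  have hτμ : μ ^ 2 * β ^ (-(2 : ℝ)) * ε ^ (2 - 2 * α) = τ * μ := by
    rw [hτ]
    ring
  have hstep : τ * ‖gradient f x‖ ^ 2 ≤ μ * ‖x - ustar‖ ^ 2 := by
    calc τ * ‖gradient f x‖ ^ 2 ≤ τ * (β * ‖x - ustar‖ ^ α) ^ 2 := by gcongr
      _ = μ * (ε ^ (2 - 2 * α) * (‖x - ustar‖ ^ α) ^ 2) := by
        rw [hτ, hβ2]
        field_simp
      _ ≤ μ * ‖x - ustar‖ ^ 2 := by gcongr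
  have hexpand : ‖(x - τ • gradient f x) - ustar‖ ^ 2 =
      ‖x - ustar‖ ^ 2 - 2 * (τ * ⟪gradient f x, x - ustar⟫) + τ * (τ * ‖gradient f x‖ ^ 2) := by
    rw [sub_right_comm, norm_sub_sq_real, inner_smul_right, real_inner_comm, norm_smul,
      mul_pow, Real.norm_eq_abs, sq_abs]
    ring
  have hdecr : ‖(x - τ • gradient f x) - ustar‖ ^ 2 ≤
      (1 - μ ^ 2 * β ^ (-(2 : ℝ)) * ε ^ (2 - 2 * α)) * ‖x - ustar‖ ^ 2 := by
    rw [hexpand, hτμ]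
    linarith [mul_le_mul_of_nonneg_left hcoer hτ0, mul_le_mul_of_nonneg_left hstep hτ0]
  refine ⟨hdecr, ?_, hx2⟩
  refine (sq_le_sq₀ (norm_nonneg _) (norm_nonneg _)).mp
    (hdecr.trans (mul_le_of_le_one_left (by positivity) ?_))
  exact sub_le_self _ (by positivity)
end

section
/- Let u* be the unique minimizer of f and let τ > 0. For every u ∈ ℝⁿ with ‖u - u*‖ ≤ δ, one has ‖(u - τ ∇f(u)) - u*‖² ≤ (1 - 2μτ) ‖u - u*‖² + β² τ² ‖u - u*‖^{2α}. -/
open Real Set RealInnerProductSpace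

/-- One-step estimate of the gradient descent map towards the unique minimizer `u*`: for any
`τ > 0` and any `u` with `‖u - u*‖ ≤ δ`,
`‖(u - τ∇f(u)) - u*‖² ≤ (1 - 2μτ)‖u - u*‖² + β²τ²‖u - u*‖^{2α}`. -/
theorem gradient_descent_step_toward_minimizer
    {n : ℕ} (f : EuclideanSpace ℝ (Fin n) → ℝ) (μ : ℝ) (hμ : 0 < μ)
    (hf : ContDiff ℝ 1 f)
    (hsc : ∀ x y : EuclideanSpace ℝ (Fin n),
      f x - f y ≥ ⟪gradient f y, x - y⟫ + μ / 2 * ‖x - y‖ ^ 2)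
    (α β δ : ℝ) (hα : 0 < α) (hα1 : α ≤ 1) (hβ : 0 < β) (hδ : 0 < δ)
    (hH : ∀ x y : EuclideanSpace ℝ (Fin n),
      ‖x - y‖ ≤ δ → ‖gradient f x - gradient f y‖ ≤ β * ‖x - y‖ ^ α)
    (ustar : EuclideanSpace ℝ (Fin n))
    (hmin : ∀ y, f ustar ≤ f y)
    (huniq : ∀ y, (∀ z, f y ≤ f z) → y = ustar)
    (τ : ℝ) (hτ : 0 < τ) :
    ∀ x : EuclideanSpace ℝ (Fin n), ‖x - ustar‖ ≤ δ →
      ‖(x - τ • gradient f x) - ustar‖ ^ 2 ≤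
        (1 - 2 * μ * τ) * ‖x - ustar‖ ^ 2 + β ^ 2 * τ ^ 2 * ‖x - ustar‖ ^ (2 * α) := by
  intro x hx
  have hgrad : gradient f ustar = 0 := by
    have hmin' : IsLocalMin f ustar := Filter.Eventually.of_forall hmin
    simp [gradient, hmin'.fderiv_eq_zero]
  have hnorm : ‖gradient f x‖ ≤ β * ‖x - ustar‖ ^ α := by
    simpa [hgrad] using hH x ustar hx
  have hmono : μ * ‖x - ustar‖ ^ 2 ≤ ⟪x - ustar, gradient f x⟫ := by
    have h₁ := hsc x ustar
    have h₂ := hsc ustar x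
    rw [hgrad, inner_zero_left] at h₁
    rw [← neg_sub x ustar, inner_neg_right, norm_neg, real_inner_comm] at h₂
    linarith
  have hsq : ‖gradient f x‖ ^ 2 ≤ β ^ 2 * ‖x - ustar‖ ^ (2 * α) := by
    calc ‖gradient f x‖ ^ 2 ≤ (β * ‖x - ustar‖ ^ α) ^ 2 := by gcongr
      _ = β ^ 2 * ‖x - ustar‖ ^ (2 * α) := by
        rw [mul_pow, mul_comm 2 α, Real.rpow_mul (norm_nonneg _), Real.rpow_two]
  rw [sub_right_comm, norm_sub_sq_real, real_inner_smul_right, norm_smul, mul_pow,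
    Real.norm_eq_abs, sq_abs]
  have h₁ := mul_le_mul_of_nonneg_left hmono hτ.le
  have h₂ := mul_le_mul_of_nonneg_left hsq (sq_nonneg τ)
  linarith
end

section
/- Let u* be the unique minimizer of f, and let ε > 0 satisfy μ² β^{-2} ε^{2-2α} < 1 and ε < ‖u_0 - u*‖. Let {u_k} be the gradient descent iterates u_{k+1} = u_k - τ ∇f(u_k) with fixed stepsize τ = μ β^{-2} ε^{2-2α} and initial point u_0 satisfying ‖u_0 - u*‖ ≤ δ. Then there exists k ≤ ⌈ (2β²/μ²) log(‖u_0 - u*‖/ε) ε^{2α-2} ⌉ such that ‖u_k - u*‖ ≤ ε. -/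
open Real Set RealInnerProductSpace

section

variable {E : Type*} [NormedAddCommGroup E] [InnerProductSpace ℝ E]

/-- A strongly convex function grows at least quadratically away from its minimizer, measured by
its gradient. -/
theorem mul_sq_norm_le_inner_gradient [CompleteSpace E] {f : E → ℝ} {μ : ℝ}
    (hsc : ∀ x y : E, f x - f y ≥ ⟪gradient f y, x - y⟫ + μ / 2 * ‖x - y‖ ^ 2)
    {z : E} (hz : gradient f z = 0) (x : E) :
    μ * ‖x - z‖ ^ 2 ≤ ⟪gradient f x, x - z⟫ := by
  have h1 := hsc x z
  have h2 := hsc z x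
  rw [hz, inner_zero_left] at h1
  rw [← neg_sub x z, inner_neg_right, norm_neg] at h2
  linarith

/-- One step in a direction `g` with `μ ‖v‖² ≤ ⟪g, v⟫` and `‖g‖ ≤ β ‖v‖ ^ α` contracts the squared
norm as long as `ε ≤ ‖v‖`. -/
theorem sq_norm_sub_smul_le {v g : E} {μ α β ε τ : ℝ} (hμ : 0 < μ) (hα1 : α ≤ 1)
    (hβ : 0 < β) (hε : 0 < ε) (hτ : τ = μ * β ^ (-(2 : ℝ)) * ε ^ (2 - 2 * α))
    (hinner : μ * ‖v‖ ^ 2 ≤ ⟪g, v⟫) (hg : ‖g‖ ≤ β * ‖v‖ ^ α) (hv : ε ≤ ‖v‖) :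
    ‖v - τ • g‖ ^ 2 ≤ (1 - τ * μ) * ‖v‖ ^ 2 := by
  have hr : 0 < ‖v‖ := hε.trans_le hv
  have hτ0 : 0 < τ := by rw [hτ]; positivity
  have hpow : (‖v‖ ^ α) ^ 2 ≤ ‖v‖ ^ 2 * ε ^ (2 * α - 2) := by
    calc (‖v‖ ^ α) ^ 2 = ‖v‖ ^ 2 * ‖v‖ ^ (2 * α - 2) := by
          rw [← Real.rpow_natCast, ← Real.rpow_mul hr.le, ← Real.rpow_natCast ‖v‖ 2,
            ← Real.rpow_add hr]
          congr 1
          push_cast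
          ring
      _ ≤ ‖v‖ ^ 2 * ε ^ (2 * α - 2) :=
          mul_le_mul_of_nonneg_left
            (Real.rpow_le_rpow_of_nonpos hε hv (by linarith)) (by positivity)
  have hstep : τ * (β ^ 2 * ε ^ (2 * α - 2)) = μ := by
    have hb : β ^ (-(2 : ℝ)) * β ^ 2 = 1 := by
      rw [← Real.rpow_natCast, ← Real.rpow_add hβ]
      norm_num
    have he : ε ^ (2 - 2 * α) * ε ^ (2 * α - 2) = 1 := by
      rw [← Real.rpow_add hε]
      ring_nf
      exact Real.rpow_zero ε
    rw [hτ]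
    calc _ = μ * (β ^ (-(2 : ℝ)) * β ^ 2) * (ε ^ (2 - 2 * α) * ε ^ (2 * α - 2)) := by ring
      _ = μ := by rw [hb, he]; ring
  have hg2 : τ * ‖g‖ ^ 2 ≤ μ * ‖v‖ ^ 2 := by
    calc τ * ‖g‖ ^ 2 ≤ τ * (β * ‖v‖ ^ α) ^ 2 := by gcongr
      _ = τ * β ^ 2 * (‖v‖ ^ α) ^ 2 := by ring
      _ ≤ τ * β ^ 2 * (‖v‖ ^ 2 * ε ^ (2 * α - 2)) := by gcongr
      _ = τ * (β ^ 2 * ε ^ (2 * α - 2)) * ‖v‖ ^ 2 := by ring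
      _ = μ * ‖v‖ ^ 2 := by rw [hstep]
  rw [norm_sub_sq_real, norm_smul, Real.norm_of_nonneg hτ0.le, inner_smul_right,
    real_inner_comm]
  have h1 := mul_le_mul_of_nonneg_left hinner hτ0.le
  have h2 := mul_le_mul_of_nonneg_left hg2 hτ0.le
  linarith [mul_pow τ ‖g‖ 2]

end

/-- Refined complexity result for gradient descent with fixed stepsize
`τ = μ β^{-2} ε^{2-2α}` started at a point with `‖u₀ - u*‖ ≤ δ`: within at most
`⌈(2β²/μ²) log(‖u₀ - u*‖/ε) ε^{2α-2}⌉` iterations, some iterate satisfies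
`‖u_k - u*‖ ≤ ε`. -/
theorem gradient_descent_refined_complexity
    {n : ℕ} (f : EuclideanSpace ℝ (Fin n) → ℝ) (μ : ℝ) (hμ : 0 < μ)
    (hf : ContDiff ℝ 1 f)
    (hsc : ∀ x y : EuclideanSpace ℝ (Fin n),
      f x - f y ≥ ⟪gradient f y, x - y⟫ + μ / 2 * ‖x - y‖ ^ 2)
    (α β δ : ℝ) (hα : 0 < α) (hα1 : α ≤ 1) (hβ : 0 < β) (hδ : 0 < δ)
    (hH : ∀ x y : EuclideanSpace ℝ (Fin n),
      ‖x - y‖ ≤ δ → ‖gradient f x - gradient f y‖ ≤ β * ‖x - y‖ ^ α)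
    (ustar : EuclideanSpace ℝ (Fin n))
    (hmin : ∀ y, f ustar ≤ f y)
    (huniq : ∀ y, (∀ z, f y ≤ f z) → y = ustar)
    (ε : ℝ) (hε : 0 < ε) (hε1 : μ ^ 2 * β ^ (-(2 : ℝ)) * ε ^ (2 - 2 * α) < 1)
    (τ : ℝ) (hτ : τ = μ * β ^ (-(2 : ℝ)) * ε ^ (2 - 2 * α))
    (uk : ℕ → EuclideanSpace ℝ (Fin n))
    (hukrec : ∀ k : ℕ, uk (k + 1) = uk k - τ • gradient f (uk k))
    (huk0 : ‖uk 0 - ustar‖ ≤ δ) (hε2 : ε < ‖uk 0 - ustar‖) :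
    ∃ k : ℕ, k ≤ ⌈2 * β ^ 2 / μ ^ 2 * Real.log (‖uk 0 - ustar‖ / ε) *
        ε ^ (2 * α - 2)⌉₊ ∧ ‖uk k - ustar‖ ≤ ε := by
  have hgrad : gradient f ustar = 0 := by
    have h : IsLocalMin f ustar := Filter.Eventually.of_forall hmin
    rw [gradient, h.fderiv_eq_zero, map_zero]
  have hq0 : 0 < τ * μ := by rw [hτ]; positivity
  have hq1 : τ * μ < 1 := by
    rw [hτ]
    linarith
  have hr0 : 0 < ‖uk 0 - ustar‖ := hε.trans hε2
  by_contra! hcon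
  set N := ⌈2 * β ^ 2 / μ ^ 2 * Real.log (‖uk 0 - ustar‖ / ε) * ε ^ (2 * α - 2)⌉₊ with hN
  have hbound : ∀ k ≤ N, ‖uk k - ustar‖ ^ 2 ≤ (1 - τ * μ) ^ k * ‖uk 0 - ustar‖ ^ 2 := by
    intro k
    induction k with
    | zero => simp
    | succ k ih =>
      intro hk
      have hkN : k ≤ N := by omega
      have hδk : ‖uk k - ustar‖ ≤ δ := by
        refine le_trans ((sq_le_sq₀ (norm_nonneg _) hr0.le).1 ?_) huk0
        refine (ih hkN).trans (mul_le_of_le_one_left (by positivity) ?_)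
        exact pow_le_one₀ (by linarith) (by linarith)
      have hg : ‖gradient f (uk k)‖ ≤ β * ‖uk k - ustar‖ ^ α := by
        simpa [hgrad] using hH (uk k) ustar hδk
      have h := sq_norm_sub_smul_le hμ hα1 hβ hε hτ
        (mul_sq_norm_le_inner_gradient hsc hgrad (uk k)) hg (hcon k hkN).le
      rw [hukrec, sub_right_comm, pow_succ' (1 - τ * μ), mul_assoc]
      exact h.trans (mul_le_mul_of_nonneg_left (ih hkN) (by linarith))
  have hlog : 2 * Real.log (‖uk 0 - ustar‖ / ε) ≤ τ * μ * N := by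
    have hceil := Nat.le_ceil
      (2 * β ^ 2 / μ ^ 2 * Real.log (‖uk 0 - ustar‖ / ε) * ε ^ (2 * α - 2))
    rw [← hN] at hceil
    refine le_trans (le_of_eq ?_) (mul_le_mul_of_nonneg_left hceil hq0.le)
    rw [hτ, show 2 * α - 2 = -(2 - 2 * α) by ring, Real.rpow_neg hε.le, Real.rpow_neg hβ.le,
      Real.rpow_two]
    have := (Real.rpow_pos_of_pos hε (2 - 2 * α)).ne'
    field_simp
  have hexp : (1 - τ * μ) ^ N * ‖uk 0 - ustar‖ ^ 2 ≤ ε ^ 2 := by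
    have h1 : (1 - τ * μ) ^ N ≤ Real.exp (-(2 * Real.log (‖uk 0 - ustar‖ / ε))) := by
      calc (1 - τ * μ) ^ N ≤ Real.exp (-(τ * μ)) ^ N :=
            pow_le_pow_left₀ (by linarith) (Real.one_sub_le_exp_neg _) N
        _ = Real.exp (-(τ * μ * N)) := by rw [← Real.exp_nat_mul]; ring_nf
        _ ≤ _ := Real.exp_le_exp.2 (by linarith)
    have h2 : Real.exp (-(2 * Real.log (‖uk 0 - ustar‖ / ε))) = (ε / ‖uk 0 - ustar‖) ^ 2 := by
      rw [Real.exp_neg, two_mul, Real.exp_add, Real.exp_log (div_pos hr0 hε), ← sq, ← inv_pow,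
        inv_div]
    calc _ ≤ (ε / ‖uk 0 - ustar‖) ^ 2 * ‖uk 0 - ustar‖ ^ 2 := by
          rw [← h2]; gcongr
      _ = ε ^ 2 := by field_simp
  have hlt := pow_lt_pow_left₀ (hcon N le_rfl) hε.le two_ne_zero
  linarith [hbound N le_rfl]
end

section
/- Let A be a symmetric positive definite n×n real matrix, α ∈ (0,1), u* ∈ ℝⁿ, and c = A u* + (u*)_+^α (positive part and power taken componentwise). Define f : ℝⁿ → ℝ by f(u) = (1/2) uᵀ A u + (1/(1+α)) Σ_{i=1}^n ((u_i)_+)^{1+α} - cᵀ u. Then f is μ-strongly convex with μ = λ_min(A) (the smallest eigenvalue of A), its gradient is ∇f(u) = A u + u_+^α - c, and u* is the unique global minimizer of f. -/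
open Real Set RealInnerProductSpace

/-- The smallest-eigenvalue half of the Rayleigh quotient bound. -/
lemma Matrix.IsHermitian.mul_norm_sq_le_inner {ι : Type*} [Fintype ι] [DecidableEq ι]
    {A : Matrix ι ι ℝ} (hA : A.IsHermitian) {μ : ℝ} (hμ : ∀ i, μ ≤ hA.eigenvalues i)
    (x : EuclideanSpace ℝ ι) : μ * ‖x‖ ^ 2 ≤ ⟪x, A.toEuclideanLin x⟫ := by
  have hcoord (i : ι) : ⟪hA.eigenvectorBasis i, A.toEuclideanLin x⟫ =
      hA.eigenvalues i * ⟪hA.eigenvectorBasis i, x⟫ := by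
    have heig : A.toEuclideanLin (hA.eigenvectorBasis i) =
        hA.eigenvalues i • hA.eigenvectorBasis i := by
      ext j
      simpa using congrFun (hA.mulVec_eigenvectorBasis i) j
    rw [← isSymmetric_toEuclideanLin_iff.mpr hA, heig, real_inner_smul_left]
  rw [← hA.eigenvectorBasis.sum_sq_norm_inner_right, ← hA.eigenvectorBasis.sum_inner_mul_inner,
    Finset.mul_sum]
  refine Finset.sum_le_sum fun i _ => ?_
  rw [hcoord, real_inner_comm, Real.norm_eq_abs, sq_abs]
  nlinarith [mul_le_mul_of_nonneg_right (hμ i) (sq_nonneg ⟪x, hA.eigenvectorBasis i⟫)]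

/-- A function with a subgradient at every point, continuous at `y`, has it as gradient there. -/
lemma hasGradientAt_of_subgradient {E : Type*} [NormedAddCommGroup E] [InnerProductSpace ℝ E]
    [CompleteSpace E] {f : E → ℝ} {G : E → E} {y : E}
    (hsub : ∀ x y, ⟪G y, x - y⟫ ≤ f x - f y) (hG : ContinuousAt G y) :
    HasGradientAt f (G y) y := by
  rw [hasGradientAt_iff_isLittleO, Asymptotics.isLittleO_iff]
  intro ε hε
  filter_upwards [Metric.continuousAt_iff'.mp hG ε hε] with x hx
  have hlower := hsub x y
  have hupper := hsub y x
  have hcs := real_inner_le_norm (G x - G y) (x - y)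
  have hle : ‖G x - G y‖ * ‖x - y‖ ≤ ε * ‖x - y‖ := by
    rw [dist_eq_norm] at hx
    gcongr
  rw [inner_sub_left] at hcs
  rw [← neg_sub x y, inner_neg_right] at hupper
  rw [Real.norm_eq_abs, abs_le]
  constructor <;> nlinarith [norm_nonneg (x - y)]

/-- The tangent-line inequality for the convex function `t ↦ (t₊) ^ (1 + α) / (1 + α)`. -/
lemma posPart_rpow_tangent_le {α : ℝ} (hα : 0 < α) (s t : ℝ) :
    max t 0 ^ α * (s - t) ≤
      1 / (1 + α) * max s 0 ^ (1 + α) - 1 / (1 + α) * max t 0 ^ (1 + α) := by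
  have hα' : 0 < 1 + α := by positivity
  have ha : 0 ≤ max s 0 := le_max_right _ _
  have hb : 0 ≤ max t 0 := le_max_right _ _
  have hyoung := Real.geom_mean_le_arith_mean2_weighted (w₁ := 1 / (1 + α)) (w₂ := α / (1 + α))
    (by positivity) (by positivity) (Real.rpow_nonneg ha (1 + α)) (Real.rpow_nonneg hb (1 + α))
    (by field_simp)
  rw [← Real.rpow_mul ha, ← Real.rpow_mul hb, mul_one_div_cancel hα'.ne', Real.rpow_one,
    mul_div_cancel₀ _ hα'.ne'] at hyoung
  have hs : max t 0 ^ α * s ≤ max t 0 ^ α * max s 0 :=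
    mul_le_mul_of_nonneg_left (le_max_left _ _) (Real.rpow_nonneg hb α)
  have ht : max t 0 ^ α * t = max t 0 ^ (1 + α) := by
    rcases le_total t 0 with h | h
    · simp [max_eq_right h, Real.zero_rpow hα.ne', Real.zero_rpow hα'.ne']
    · rw [max_eq_left h, Real.rpow_add' h hα'.ne', Real.rpow_one, mul_comm]
  have hw : α / (1 + α) = 1 - 1 / (1 + α) := by field_simp; ring
  rw [hw] at hyoung
  linarith

/-- For a symmetric positive definite matrix `A`, `α ∈ (0,1)`, `u* ∈ ℝⁿ` and
`c = A u* + (u*)₊^α`, the function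
`f(u) = (1/2) uᵀ A u + (1/(1+α)) ∑ᵢ ((uᵢ)₊)^{1+α} - cᵀ u`
is `μ`-strongly convex with `μ = λ_min(A)`, its gradient is `∇f(u) = A u + u₊^α - c`,
and `u*` is the unique global minimizer of `f`. -/
theorem test_problem_strongly_convex
    {n : ℕ} (A : Matrix (Fin n) (Fin n) ℝ) (hA : A.PosDef)
    (α : ℝ) (hα : 0 < α) (hα1 : α < 1)
    (ustar : EuclideanSpace ℝ (Fin n))
    (c : EuclideanSpace ℝ (Fin n))
    (hc : ∀ i, c i = A.mulVec (fun j => ustar j) i + max (ustar i) 0 ^ α)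
    (f : EuclideanSpace ℝ (Fin n) → ℝ)
    (hf : ∀ u : EuclideanSpace ℝ (Fin n),
      f u = 1 / 2 * ∑ i, u i * A.mulVec (fun j => u j) i +
        1 / (1 + α) * ∑ i, max (u i) 0 ^ (1 + α) - ∑ i, c i * u i)
    (μ : ℝ) (hμ : IsLeast (Set.range hA.1.eigenvalues) μ) :
    (∀ x y : EuclideanSpace ℝ (Fin n),
      f x - f y ≥ ⟪gradient f y, x - y⟫ + μ / 2 * ‖x - y‖ ^ 2) ∧
    (∀ u : EuclideanSpace ℝ (Fin n), ∀ i,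
      gradient f u i = A.mulVec (fun j => u j) i + max (u i) 0 ^ α - c i) ∧
    (∀ y : EuclideanSpace ℝ (Fin n), y ≠ ustar → f ustar < f y) := by
  set T := A.toEuclideanLin
  have hTapp (u : EuclideanSpace ℝ (Fin n)) (i : Fin n) :
      T u i = A.mulVec (fun j => u j) i := rfl
  have hsymm : T.IsSymmetric := Matrix.isSymmetric_toEuclideanLin_iff.mpr hA.1
  let G (u : EuclideanSpace ℝ (Fin n)) : EuclideanSpace ℝ (Fin n) :=
    T u + WithLp.toLp 2 (fun i => max (u i) 0 ^ α) - c
  have hGcont : Continuous G := by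
    have hTcont : Continuous T := T.continuous_of_finiteDimensional
    have hpow : Continuous fun u : EuclideanSpace ℝ (Fin n) =>
        WithLp.toLp 2 (fun i => max (u i) 0 ^ α) :=
      (PiLp.continuous_toLp 2 _).comp <| continuous_pi fun i =>
        Continuous.rpow_const (by fun_prop) fun _ => Or.inr hα.le
    exact (hTcont.add hpow).sub continuous_const
  have hμpos : 0 < μ := by
    obtain ⟨i, rfl⟩ := hμ.1
    exact hA.eigenvalues_pos i
  have hfT (u : EuclideanSpace ℝ (Fin n)) :
      f u = 1 / 2 * ⟪u, T u⟫ + ∑ i, 1 / (1 + α) * max (u i) 0 ^ (1 + α) - ⟪c, u⟫ := by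
    simp only [hf, PiLp.inner_apply, hTapp, Finset.mul_sum, RCLike.inner_apply, conj_trivial,
      mul_comm]
  have hstrong (x y : EuclideanSpace ℝ (Fin n)) :
      ⟪G y, x - y⟫ + μ / 2 * ‖x - y‖ ^ 2 ≤ f x - f y := by
    have hquad := hA.1.mul_norm_sq_le_inner (fun i => hμ.2 ⟨i, rfl⟩) (x - y)
    have hexpand : ⟪x - y, T (x - y)⟫ = ⟪x, T x⟫ - ⟪y, T y⟫ - 2 * ⟪T y, x - y⟫ := by
      have hxy : ⟪y, T x⟫ = ⟪T y, x⟫ := (hsymm y x).symm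
      simp only [map_sub, inner_sub_left, inner_sub_right, hxy, real_inner_comm (T y) x,
        real_inner_comm (T y) y]
      ring
    have hpow : ⟪WithLp.toLp 2 (fun i => max (y i) 0 ^ α), x - y⟫ ≤
        ∑ i, 1 / (1 + α) * max (x i) 0 ^ (1 + α) -
          ∑ i, 1 / (1 + α) * max (y i) 0 ^ (1 + α) := by
      rw [← Finset.sum_sub_distrib, PiLp.inner_apply]
      refine Finset.sum_le_sum fun i _ => ?_
      simpa [mul_comm] using posPart_rpow_tangent_le hα (x i) (y i)
    have hc' : ⟪c, x - y⟫ = ⟪c, x⟫ - ⟪c, y⟫ := inner_sub_right _ _ _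
    rw [hfT, hfT]
    simp only [G, inner_sub_left (T y + _), inner_add_left]
    linarith
  have hgrad (y : EuclideanSpace ℝ (Fin n)) : gradient f y = G y :=
    (hasGradientAt_of_subgradient (fun x y => le_trans
      (le_add_of_nonneg_right (by positivity)) (hstrong x y)) hGcont.continuousAt).gradient
  refine ⟨fun x y => hgrad y ▸ hstrong x y, fun u i => by rw [hgrad]; rfl, fun y hy => ?_⟩
  have hGstar : G ustar = 0 := by
    ext i
    simp [G, hTapp, hc]
  have hmin := hstrong y ustar
  have hnorm : 0 < ‖y - ustar‖ := norm_pos_iff.mpr (sub_ne_zero.mpr hy)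
  rw [hGstar, inner_zero_left] at hmin
  have : 0 < μ / 2 * ‖y - ustar‖ ^ 2 := by positivity
  linarith
end
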